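/- Let k ≥ 4. There exist constants C>0 and h_0>0, depending only on k, α, β, γ, b-a and the quasi-uniformity constant c, such that whenever h ≤ h_0, u is 2k-times continuously differentiable with u(a)=u(b)=0, f := -αu''+βu'+γu, and ū_h is a Gauss collocation solution, then |(u-ū_h)(l_{im})| ≤ C h^{k+2} ‖u‖_{2k,∞} at each of the k-3 interior Jacobi points l_{im} of every element τ_i. -/

import Mathlib

open Set Finset intervalIntegral

/-- The Legendre polynomial of degree `n` (Rodrigues formula), as a real function. -/
noncomputable def legendre (n : ℕ) : ℝ → ℝ :=
  fun s => (1 / ((2 : ℝ) ^ n * n.factorial)) * iteratedDeriv n (fun t : ℝ => (t ^ 2 - 1) ^ n) s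

/-- The affine map sending `[-1,1]` onto `[p,q]`. -/
noncomputable def affMap (p q s : ℝ) : ℝ := (p + q) / 2 + s * (q - p) / 2

/-- `x 0 = a < x 1 < ... < x N = b` is a partition of `[a,b]`. -/
def IsMesh (a b : ℝ) (N : ℕ) (x : ℕ → ℝ) : Prop :=
  1 ≤ N ∧ x 0 = a ∧ x N = b ∧ ∀ i < N, x i < x (i + 1)

/-- `h` is the maximal element length `h = max_i (x i - x (i-1))`. -/
def IsMeshSize (N : ℕ) (x : ℕ → ℝ) (h : ℝ) : Prop :=
  (∀ i ∈ Finset.Icc 1 N, x i - x (i - 1) ≤ h) ∧ ∃ i ∈ Finset.Icc 1 N, x i - x (i - 1) = h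

/-- Quasi-uniformity with constant `c`: `h ≤ c · h_i` for all elements. -/
def IsQuasiUniform (N : ℕ) (x : ℕ → ℝ) (h c : ℝ) : Prop :=
  ∀ i ∈ Finset.Icc 1 N, h ≤ c * (x i - x (i - 1))

/-- `P i` are the element polynomials (degree ≤ k) of a member of `V_h^0`:
a C¹ piecewise polynomial vanishing at both ends of `[a,b]`. -/
def IsVh0 (k N : ℕ) (x : ℕ → ℝ) (P : ℕ → Polynomial ℝ) : Prop :=
  (∀ i ∈ Finset.Icc 1 N, (P i).natDegree ≤ k) ∧
  (∀ i ∈ Finset.Icc 1 (N - 1), (P i).eval (x i) = (P (i + 1)).eval (x i)) ∧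
  (∀ i ∈ Finset.Icc 1 (N - 1),
      (Polynomial.derivative (P i)).eval (x i) = (Polynomial.derivative (P (i + 1))).eval (x i)) ∧
  (P 1).eval (x 0) = 0 ∧ (P N).eval (x N) = 0

/-- `P i` are the element polynomials of a Petrov–Galerkin solution `u_h ∈ V_h^0`:
`∑_i ∫_{τ_i} (-α u_h'' + β u_h' + γ u_h) v_h = ∫_a^b f v_h` for all `v_h ∈ W_h`. -/
def IsPGSol (k N : ℕ) (x : ℕ → ℝ) (α β γ : ℝ) (f : ℝ → ℝ) (P : ℕ → Polynomial ℝ) : Prop :=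
  IsVh0 k N x P ∧
  ∀ Q : ℕ → Polynomial ℝ, (∀ i ∈ Finset.Icc 1 N, (Q i).natDegree ≤ k - 2) →
    (∑ i ∈ Finset.Icc 1 N, ∫ t in (x (i - 1))..(x i),
        (-α * ((Polynomial.derivative (Polynomial.derivative (P i))).eval t)
            + β * ((Polynomial.derivative (P i)).eval t) + γ * (P i).eval t) * (Q i).eval t)
      = ∑ i ∈ Finset.Icc 1 N, ∫ t in (x (i - 1))..(x i), f t * (Q i).eval t

/-- `P i` are the element polynomials of a Gauss collocation solution `ū_h ∈ V_h^0`: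
`(-α ū_h'' + β ū_h' + γ ū_h)(g) = f(g)` at every Gauss point `g` of every element. -/
def IsGaussSol (k N : ℕ) (x : ℕ → ℝ) (α β γ : ℝ) (f : ℝ → ℝ) (P : ℕ → Polynomial ℝ) : Prop :=
  IsVh0 k N x P ∧
  ∀ i ∈ Finset.Icc 1 N, ∀ s ∈ Set.Ioo (-1 : ℝ) 1, legendre (k - 1) s = 0 →
    -α * ((Polynomial.derivative (Polynomial.derivative (P i))).eval (affMap (x (i - 1)) (x i) s))
        + β * ((Polynomial.derivative (P i)).eval (affMap (x (i - 1)) (x i) s))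
        + γ * (P i).eval (affMap (x (i - 1)) (x i) s)
      = f (affMap (x (i - 1)) (x i) s)

/-- `p` is the elementwise truncated Jacobi projection of `u` on the element `[xl, xr]`:
the polynomial of degree ≤ k matching `u` and `u'` at both endpoints with
`(u - p)'' ⊥ P_{k-2}` in `L²(xl, xr)`. -/
def IsElemProj (k : ℕ) (u : ℝ → ℝ) (xl xr : ℝ) (p : Polynomial ℝ) : Prop :=
  p.natDegree ≤ k ∧ p.eval xl = u xl ∧ p.eval xr = u xr ∧
  (Polynomial.derivative p).eval xl = deriv u xl ∧
  (Polynomial.derivative p).eval xr = deriv u xr ∧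
  ∀ q : Polynomial ℝ, q.natDegree ≤ k - 2 →
    (∫ t in xl..xr,
        (iteratedDeriv 2 u t - (Polynomial.derivative (Polynomial.derivative p)).eval t)
          * q.eval t) = 0

section Reference

open Polynomial

/-- The unnormalised Legendre polynomial `(d/ds)^n (s^2-1)^n`. -/
noncomputable def rodrigues (n : ℕ) : ℝ[X] := derivative^[n] ((X ^ 2 - 1) ^ n)

theorem iteratedDeriv_polynomial_eval (p : ℝ[X]) (j : ℕ) :
    iteratedDeriv j (fun t => p.eval t) = fun t => (derivative^[j] p).eval t := by
  induction j with
  | zero => simp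
  | succ j ih =>
    rw [iteratedDeriv_succ, ih, Function.iterate_succ_apply']
    ext t
    exact Polynomial.deriv _

theorem legendre_eq (n : ℕ) :
    legendre n = fun s => (C (1 / ((2 : ℝ) ^ n * n.factorial)) * rodrigues n).eval s := by
  ext s
  have := congrFun (iteratedDeriv_polynomial_eval ((X ^ 2 - 1) ^ n) n) s
  simp only [eval_pow, eval_sub, eval_X, eval_one] at this
  simp [legendre, rodrigues, this]

theorem legendre_eq_zero_iff (n : ℕ) (s : ℝ) : legendre n s = 0 ↔ (rodrigues n).eval s = 0 := by
  rw [legendre_eq]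
  simp [Nat.factorial_ne_zero]

theorem iteratedDeriv_two_legendre_eq_zero_iff (n : ℕ) (s : ℝ) :
    iteratedDeriv 2 (legendre n) s = 0 ↔ (derivative^[2] (rodrigues n)).eval s = 0 := by
  rw [legendre_eq, iteratedDeriv_polynomial_eval, iterate_derivative_C_mul]
  simp [Nat.factorial_ne_zero]

theorem degree_rodrigues (n : ℕ) : (rodrigues n).degree = n := by
  have hmon : ((X ^ 2 - 1 : ℝ[X]) ^ n).Monic := by
    apply Monic.pow
    have := monic_X_pow_sub_C (1 : ℝ) (n := 2) (by norm_num)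
    simpa using this
  have hdeg : ((X ^ 2 - 1 : ℝ[X]) ^ n).natDegree = 2 * n := by
    have h2 : (X ^ 2 - 1 : ℝ[X]).natDegree = 2 := by
      have := natDegree_X_pow_sub_C (n := 2) (r := (1 : ℝ))
      simpa using this
    rw [natDegree_pow, h2, mul_comm]
  refine degree_eq_of_le_of_coeff_ne_zero ?_ ?_
  · refine degree_le_of_natDegree_le ?_
    have := natDegree_iterate_derivative ((X ^ 2 - 1 : ℝ[X]) ^ n) n
    rw [hdeg] at this
    unfold rodrigues
    omega
  · rw [rodrigues, coeff_iterate_derivative]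
    have h1 : ((X ^ 2 - 1 : ℝ[X]) ^ n).coeff (n + n) = 1 := by
      have := hmon.coeff_natDegree
      rwa [hdeg, two_mul] at this
    rw [h1]
    simp [Nat.descFactorial_eq_zero_iff_lt]

theorem eval_iterate_derivative_endpoint {n j : ℕ} (hj : j < n) {s : ℝ} (hs : s ^ 2 = 1) :
    (derivative^[j] ((X ^ 2 - 1 : ℝ[X]) ^ n)).eval s = 0 := by
  have h := (pow_sub_dvd_iterate_derivative_pow (X ^ 2 - 1 : ℝ[X]) n j)
  have h2 : (X ^ 2 - 1 : ℝ[X]) ∣ derivative^[j] ((X ^ 2 - 1 : ℝ[X]) ^ n) :=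
    (dvd_pow_self _ (by omega)).trans h
  obtain ⟨r, hr⟩ := h2
  rw [hr]
  simp [hs]

/-- Repeated use of Rolle's theorem: the zeros of the successive derivatives of `(s^2-1)^n`. -/
theorem exists_strictMono_roots (n j : ℕ) (hj : j ≤ n) :
    ∃ s : ℕ → ℝ, s 0 = -1 ∧ s (j + 1) = 1 ∧ (∀ i ≤ j, s i < s (i + 1)) ∧
      ∀ i, 1 ≤ i → i ≤ j → (derivative^[j] ((X ^ 2 - 1 : ℝ[X]) ^ n)).eval (s i) = 0 := by
  induction j with
  | zero =>
    refine ⟨fun i => if i = 0 then -1 else 1, by simp, by simp, ?_, ?_⟩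
    · intro i hi
      obtain rfl : i = 0 := by omega
      norm_num
    · intro i h1 h2
      omega
  | succ j ih =>
    obtain ⟨s, h0, h1, hlt, hz⟩ := ih (by omega)
    have hz' : ∀ i ≤ j + 1, (derivative^[j] ((X ^ 2 - 1 : ℝ[X]) ^ n)).eval (s i) = 0 := by
      intro i hi
      rcases Nat.eq_zero_or_pos i with rfl | hpos
      · exact eval_iterate_derivative_endpoint (by omega) (by rw [h0]; norm_num)
      rcases Nat.lt_or_ge j i with h | h
      · obtain rfl : i = j + 1 := by omega
        exact eval_iterate_derivative_endpoint (by omega) (by rw [h1]; norm_num)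
      · exact hz i hpos h
    have hr : ∀ i, ∃ t, i ≤ j → t ∈ Set.Ioo (s i) (s (i + 1)) ∧
        (derivative^[j + 1] ((X ^ 2 - 1 : ℝ[X]) ^ n)).eval t = 0 := by
      intro i
      by_cases hi : i ≤ j
      · obtain ⟨t, ht, hd⟩ := exists_deriv_eq_zero (hlt i hi)
          (f := fun t => (derivative^[j] ((X ^ 2 - 1 : ℝ[X]) ^ n)).eval t)
          (Polynomial.continuous _).continuousOn
          ((hz' i (by omega)).trans (hz' (i + 1) (by omega)).symm)
        refine ⟨t, fun _ => ⟨ht, ?_⟩⟩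
        rw [Function.iterate_succ_apply', ← Polynomial.deriv]
        exact hd
      · exact ⟨0, fun h => absurd h hi⟩
    choose t ht using hr
    refine ⟨fun i => if i = 0 then -1 else if i = j + 2 then 1 else t (i - 1), by simp, by simp,
      ?_, ?_⟩
    · intro i hi
      rcases Nat.eq_zero_or_pos i with rfl | hpos
      · have := (ht 0 (by omega)).1.1
        rw [h0] at this
        simpa using this
      · by_cases hij : i = j + 1
        · subst hij
          have := (ht j le_rfl).1.2
          rw [h1] at this
          simpa using this
        · have e1 := (ht (i - 1) (by omega)).1.2
          have e2 := (ht i (by omega)).1.1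
          rw [Nat.sub_add_cancel hpos] at e1
          have c1 : i ≠ 0 := by omega
          have c2 : i ≠ j + 2 := by omega
          simp only [c1, c2, if_false, Nat.add_eq_zero_iff, one_ne_zero, and_false,
            Nat.add_sub_cancel, show ¬ (i + 1 = j + 2) by omega]
          linarith
    · intro i hi1 hi2
      have c1 : i ≠ 0 := by omega
      have c2 : i ≠ j + 2 := by omega
      simp only [c1, c2, if_false]
      exact (ht (i - 1) (by omega)).2

theorem exists_finset_roots_rodrigues (n : ℕ) :
    ∃ G : Finset ℝ, G.card = n ∧ ∀ g ∈ G, g ∈ Set.Ioo (-1 : ℝ) 1 ∧ (rodrigues n).eval g = 0 := by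
  obtain ⟨s, h0, h1, hlt, hz⟩ := exists_strictMono_roots n n le_rfl
  have hmono : ∀ i j, i < j → j ≤ n + 1 → s i < s j := by
    intro i j hij
    induction j, hij using Nat.le_induction with
    | base => intro h; exact hlt i (by omega)
    | succ m hm ih => intro h; exact (ih (by omega)).trans (hlt m (by omega))
  refine ⟨(Finset.Icc 1 n).image s, ?_, ?_⟩
  · rw [Finset.card_image_of_injOn]
    · simp
    · intro i hi j hj hij
      simp only [Finset.coe_Icc, Set.mem_Icc] at hi hj
      rcases lt_trichotomy i j with h | h | h
      · exact absurd hij (hmono i j h (by omega)).ne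
      · exact h
      · exact absurd hij (hmono j i h (by omega)).ne'
  · intro g hg
    obtain ⟨i, hi, rfl⟩ := Finset.mem_image.1 hg
    rw [Finset.mem_Icc] at hi
    refine ⟨⟨?_, ?_⟩, hz i hi.1 hi.2⟩
    · rw [← h0]; exact hmono 0 i (by omega) (by omega)
    · rw [← h1]; exact hmono i (n + 1) (by omega) (by omega)

theorem exists_bound_eval (q : ℝ[X]) : ∃ B, 0 ≤ B ∧ ∀ s ∈ Set.Icc (-1 : ℝ) 1, |q.eval s| ≤ B := by
  obtain ⟨B, hB⟩ := isCompact_Icc.exists_bound_of_continuousOn (s := Set.Icc (-1 : ℝ) 1)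
    (f := fun s => q.eval s) q.continuous.continuousOn
  exact ⟨B, (norm_nonneg _).trans (hB 0 (by simp)), hB⟩

/-- Norm equivalence: the values at the Gauss points control a polynomial of degree `< n`
together with all its derivatives. -/
theorem exists_lebesgue_constant (n : ℕ) : ∃ K > 0, ∀ (q : ℝ[X]) (ε : ℝ), q.degree < n → 0 ≤ ε →
    (∀ s ∈ Set.Ioo (-1 : ℝ) 1, (rodrigues n).eval s = 0 → |q.eval s| ≤ ε) →
    ∀ j, ∀ s ∈ Set.Icc (-1 : ℝ) 1, |(derivative^[j] q).eval s| ≤ K * ε := by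
  obtain ⟨G, hcard, hG⟩ := exists_finset_roots_rodrigues n
  choose B hB0 hB using fun (j : ℕ) (g : ℝ) =>
    exists_bound_eval (derivative^[j] (Lagrange.basis G id g))
  refine ⟨1 + ∑ j ∈ Finset.range n, ∑ g ∈ G, B j g, ?_, ?_⟩
  · have : 0 ≤ ∑ j ∈ Finset.range n, ∑ g ∈ G, B j g :=
      Finset.sum_nonneg fun j _ => Finset.sum_nonneg fun g _ => hB0 j g
    linarith
  intro q ε hq hε hval j s hs
  have hK : 0 ≤ ∑ j ∈ Finset.range n, ∑ g ∈ G, B j g :=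
    Finset.sum_nonneg fun j _ => Finset.sum_nonneg fun g _ => hB0 j g
  rcases lt_or_ge j n with hj | hj
  · have hrep := Lagrange.eq_interpolate (s := G) (v := id) (f := q)
      (Set.injOn_id _) (by rwa [hcard])
    rw [Lagrange.interpolate_apply] at hrep
    have h1 : |(derivative^[j] q).eval s| ≤ ∑ g ∈ G, ε * B j g := by
      conv_lhs => rw [hrep, iterate_derivative_sum, eval_finsetSum]
      refine (Finset.abs_sum_le_sum_abs _ _).trans (Finset.sum_le_sum fun g hg => ?_)
      rw [iterate_derivative_C_mul, eval_mul, eval_C, abs_mul]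
      exact mul_le_mul (hval g (hG g hg).1 (hG g hg).2) (hB j g s hs) (abs_nonneg _) hε
    have h2 : ∑ g ∈ G, B j g ≤ ∑ j ∈ Finset.range n, ∑ g ∈ G, B j g :=
      Finset.single_le_sum (f := fun j => ∑ g ∈ G, B j g)
        (fun j _ => Finset.sum_nonneg fun g _ => hB0 j g) (Finset.mem_range.2 hj)
    rw [← Finset.mul_sum] at h1
    nlinarith
  · rw [iterate_derivative_eq_zero_of_degree_lt
      (hq.trans_le (by exact_mod_cast hj))]
    simp only [eval_zero, abs_zero]
    positivity

/-- Integration by parts against the Rodrigues formula. -/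
theorem exists_antiderivative_mul (n j : ℕ) (hj : j ≤ n) (q : ℝ[X]) (hq : q.degree < j) :
    ∃ H : ℝ[X], derivative H = q * derivative^[j] ((X ^ 2 - 1) ^ n) ∧
      H.eval 1 = 0 ∧ H.eval (-1) = 0 := by
  induction j generalizing q with
  | zero =>
    obtain rfl : q = 0 := by
      rw [← degree_eq_bot]
      exact Nat.WithBot.lt_zero_iff.1 hq
    exact ⟨0, by simp⟩
  | succ j ih =>
    have hq' : (derivative q).degree < j := by
      by_cases h0 : q = 0
      · simp [h0, bot_lt_iff_ne_bot]
      · have h1 := degree_derivative_lt h0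
        have h2 : q.degree ≤ j := by
          rw [degree_eq_natDegree h0] at hq ⊢
          norm_cast at hq ⊢
          omega
        exact h1.trans_le h2
    obtain ⟨H, hH, h1, h2⟩ := ih (by omega) (derivative q) hq'
    refine ⟨q * derivative^[j] ((X ^ 2 - 1) ^ n) - H, ?_, ?_, ?_⟩
    · rw [derivative_sub, derivative_mul, hH, Function.iterate_succ_apply']
      ring
    · rw [eval_sub, eval_mul, h1, eval_iterate_derivative_endpoint (by omega) (by norm_num)]
      ring
    · rw [eval_sub, eval_mul, h2, eval_iterate_derivative_endpoint (by omega) (by norm_num)]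
      ring

theorem abs_eval_sub_le (S : ℝ[X]) (ε : ℝ)
    (h : ∀ s ∈ Set.Icc (-1 : ℝ) 1, |(derivative S).eval s| ≤ ε) (s t : ℝ)
    (hs : s ∈ Set.Icc (-1 : ℝ) 1) (ht : t ∈ Set.Icc (-1 : ℝ) 1) :
    |S.eval s - S.eval t| ≤ 2 * ε := by
  have := Convex.norm_image_sub_le_of_norm_deriv_le (f := fun s => S.eval s) (C := ε)
    (fun x _ => S.differentiableAt) (fun x hx => by rw [Polynomial.deriv]; exact h x hx)
    (convex_Icc (-1 : ℝ) 1) ht hs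
  simp only [Real.norm_eq_abs] at this
  have hε : 0 ≤ ε := (abs_nonneg _).trans (h s hs)
  have h2 : |s - t| ≤ 2 := abs_le.2 ⟨by linarith [hs.1, ht.2], by linarith [hs.2, ht.1]⟩
  nlinarith

/-- Exactness of the Gauss quadrature for polynomials of degree `≤ 2n-1`, as a bound on the
increment of an antiderivative. -/
theorem exists_gauss_quadrature_constant (n : ℕ) : ∃ K > 0, ∀ (S : ℝ[X]) (ε : ℝ),
    S.natDegree ≤ 2 * n → 0 ≤ ε →
    (∀ s ∈ Set.Ioo (-1 : ℝ) 1, (rodrigues n).eval s = 0 → |(derivative S).eval s| ≤ ε) →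
    |S.eval 1 - S.eval (-1)| ≤ K * ε := by
  obtain ⟨K, hK, hleb⟩ := exists_lebesgue_constant n
  refine ⟨2 * K, by positivity, fun S ε hS hε hval => ?_⟩
  have hne : rodrigues n ≠ 0 := fun h => by
    have := degree_rodrigues n
    simp [h] at this
  set A := derivative S / rodrigues n with hA
  set R := derivative S % rodrigues n with hR
  have hdiv : rodrigues n * A + R = derivative S := EuclideanDomain.div_add_mod _ _
  have hRdeg : R.degree < n := by
    rw [← degree_rodrigues n]
    exact EuclideanDomain.mod_lt _ hne
  have hAdeg : A.degree < n := by
    by_cases h0 : A = 0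
    · rw [h0, degree_zero]; exact bot_lt_iff_ne_bot.2 (by simp)
    have hle : (rodrigues n).degree ≤ (derivative S).degree := by
      rw [← not_lt, ← Polynomial.div_eq_zero_iff hne]
      exact h0
    have h1 := degree_add_div hne hle
    rw [← hA, degree_rodrigues n, degree_eq_natDegree h0] at h1
    have h3 : (derivative S).natDegree ≤ S.natDegree - 1 := natDegree_derivative_le S
    have h4 := (degree_le_natDegree (p := derivative S)).trans
      (Nat.cast_le (α := WithBot ℕ).2 (h3.trans (Nat.sub_le_sub_right hS 1)))
    rw [← h1] at h4
    rw [degree_eq_natDegree h0]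
    rcases Nat.eq_zero_or_pos n with rfl | hn
    · exfalso
      apply h0
      have : S.natDegree = 0 := by omega
      rw [hA, derivative_of_natDegree_zero this, EuclideanDomain.zero_div]
    · norm_cast at h4 ⊢
      omega
  obtain ⟨H, hH, h1, h2⟩ := exists_antiderivative_mul n n le_rfl A hAdeg
  have hder : derivative (S - H) = R := by
    rw [derivative_sub, hH, ← hdiv, rodrigues]
    ring
  have hRval : ∀ s ∈ Set.Icc (-1 : ℝ) 1, |R.eval s| ≤ K * ε := by
    refine hleb R ε hRdeg hε (fun s hs h0 => ?_) 0
    have := hval s hs h0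
    rw [← hdiv] at this
    simpa [h0] using this
  have := abs_eval_sub_le (S - H) (K * ε) (by rwa [hder]) 1 (-1) (by simp) (by simp)
  simpa [h1, h2, mul_assoc] using this

theorem legendre_ode_aux (n j : ℕ) :
    (X ^ 2 - 1) * derivative^[j + 2] ((X ^ 2 - 1 : ℝ[X]) ^ n)
      + C (2 * (j + 1 : ℝ)) * X * derivative^[j + 1] ((X ^ 2 - 1 : ℝ[X]) ^ n)
      + C (j * (j + 1) : ℝ) * derivative^[j] ((X ^ 2 - 1 : ℝ[X]) ^ n)
    = C (2 * n : ℝ) * X * derivative^[j + 1] ((X ^ 2 - 1 : ℝ[X]) ^ n)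
      + C (2 * n * (j + 1) : ℝ) * derivative^[j] ((X ^ 2 - 1 : ℝ[X]) ^ n) := by
  induction j with
  | zero =>
    have h0 : (X ^ 2 - 1) * derivative ((X ^ 2 - 1 : ℝ[X]) ^ n)
        = C (2 * n : ℝ) * X * (X ^ 2 - 1 : ℝ[X]) ^ n := by
      rcases n with _ | n
      · simp
      · rw [derivative_pow]
        simp only [derivative_sub, derivative_X_pow, derivative_one, Nat.add_sub_cancel, map_mul]
        simp
        ring
    have h1 := congrArg derivative h0
    simp only [derivative_mul, derivative_sub, derivative_X_pow, derivative_one, derivative_C,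
      derivative_X] at h1
    simp only [Function.iterate_succ_apply', Function.iterate_zero, id_eq] at h1 ⊢
    simp at h1 ⊢
    linear_combination h1
  | succ j ih =>
    have h1 := congrArg derivative ih
    simp only [derivative_mul, derivative_sub, derivative_X_pow, derivative_one, derivative_C,
      derivative_X, derivative_add, ← Function.iterate_succ_apply' derivative] at h1
    simp only [map_mul, map_add, map_natCast, map_ofNat, map_one, Nat.cast_add, Nat.cast_one]
      at h1 ⊢
    simp only [show j + 1 + 2 = j + 1 + 1 + 1 from rfl, Function.iterate_succ_apply] at h1 ⊢
    simp at h1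
    linear_combination h1

/-- Legendre's differential equation. -/
theorem legendre_ode (n : ℕ) :
    (X ^ 2 - 1) * derivative^[2] (rodrigues n) + C 2 * X * derivative (rodrigues n)
      = C (n * (n + 1) : ℝ) * rodrigues n := by
  have h := legendre_ode_aux n n
  have e1 : derivative^[n + 2] ((X ^ 2 - 1 : ℝ[X]) ^ n) = derivative^[2] (rodrigues n) := by
    rw [add_comm, Function.iterate_add_apply, rodrigues]
  have e2 : derivative^[n + 1] ((X ^ 2 - 1 : ℝ[X]) ^ n) = derivative (rodrigues n) := by
    rw [Function.iterate_succ_apply', rodrigues]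
  rw [e1, e2, ← rodrigues] at h
  simp only [map_mul, map_add, map_natCast, map_ofNat, map_one] at h ⊢
  linear_combination h

theorem derivative_two_jacobi (n : ℕ) :
    derivative^[2] ((X ^ 2 - 1) ^ 2 * derivative^[2] (rodrigues n))
      = C ((n * (n + 1) - 2) * (n * (n + 1)) : ℝ) * rodrigues n := by
  have h0 := legendre_ode n
  have h1 := congrArg derivative h0
  simp only [Function.iterate_succ_apply', Function.iterate_zero, id_eq] at h0 h1 ⊢
  simp only [map_mul, map_add, map_sub, map_natCast, map_ofNat, map_one] at h0 h1 ⊢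
  simp only [derivative_mul, derivative_X_pow, derivative_one, derivative_sub,
    derivative_X, derivative_add, derivative_natCast, derivative_ofNat] at h1
  have h2 : derivative ((X ^ 2 - 1) ^ 2 * derivative (derivative (rodrigues n)))
      = (X ^ 2 - 1) * ((n * (n + 1) - 2 : ℝ[X]) * derivative (rodrigues n)) := by
    simp only [derivative_mul, derivative_pow, derivative_sub, derivative_one, derivative_X]
    simp [map_ofNat] at h1 ⊢
    linear_combination (X ^ 2 - 1) * h1
  rw [h2]
  simp only [derivative_mul, derivative_sub, derivative_X_pow, derivative_one,
    derivative_add, derivative_natCast, derivative_ofNat]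
  simp [map_ofNat]
  linear_combination (n * (n + 1) - 2 : ℝ[X]) * h0

/-- A polynomial of degree `≤ n+2` is controlled at the zeros of `L_n''` by its Cauchy data at the
left end and the values of its second derivative at the Gauss points. -/
theorem exists_jacobi_point_constant (n : ℕ) (hn : 2 ≤ n) : ∃ K > 0, ∀ (S : ℝ[X]) (ε : ℝ),
    S.natDegree ≤ n + 2 → 0 ≤ ε → |S.eval (-1)| ≤ ε → |(derivative S).eval (-1)| ≤ ε →
    (∀ s ∈ Set.Ioo (-1 : ℝ) 1, (rodrigues n).eval s = 0 → |(derivative^[2] S).eval s| ≤ ε) →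
    ∀ s ∈ Set.Ioo (-1 : ℝ) 1, (derivative^[2] (rodrigues n)).eval s = 0 → |S.eval s| ≤ K * ε := by
  obtain ⟨K, hK, hleb⟩ := exists_lebesgue_constant n
  refine ⟨3 + 4 * K, by positivity, fun S ε hS hε hS0 hS1 hval s hs hroot => ?_⟩
  have hnd : (rodrigues n).natDegree = n := natDegree_eq_of_degree_eq_some (degree_rodrigues n)
  have hne : rodrigues n ≠ 0 := fun h => by
    have := degree_rodrigues n
    simp [h] at this
  have hlead : (rodrigues n).coeff n ≠ 0 := by
    have := leadingCoeff_ne_zero.2 hne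
    rwa [leadingCoeff, hnd] at this
  have hconst : ((n * (n + 1) - 2) * (n * (n + 1)) : ℝ) ≠ 0 := by
    have : (2 : ℝ) ≤ n := by exact_mod_cast hn
    have h1 : (0 : ℝ) < n * (n + 1) - 2 := by nlinarith
    have h2 : (0 : ℝ) < n * (n + 1) := by nlinarith
    positivity
  set m : ℝ := (n * (n + 1) - 2) * (n * (n + 1)) with hm
  set c : ℝ := (derivative^[2] S).coeff n / (rodrigues n).coeff n with hc
  set J : ℝ[X] := (X ^ 2 - 1) ^ 2 * derivative^[2] (rodrigues n) with hJ
  set R : ℝ[X] := derivative^[2] S - C c * rodrigues n with hR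
  set V : ℝ[X] := S - C (c / m) * J with hV
  have hS2 : (derivative^[2] S).natDegree ≤ n := by
    have := natDegree_iterate_derivative S 2
    omega
  have hRdeg : R.degree < n := by
    rw [degree_lt_iff_coeff_zero]
    intro j hj
    rw [hR, coeff_sub, coeff_C_mul]
    rcases hj.eq_or_lt with rfl | hlt
    · rw [hc, div_mul_cancel₀ _ hlead, sub_self]
    · rw [coeff_eq_zero_of_natDegree_lt (by omega), coeff_eq_zero_of_natDegree_lt (by omega)]
      simp
  have hRval : ∀ t ∈ Set.Icc (-1 : ℝ) 1, |R.eval t| ≤ K * ε := by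
    refine hleb R ε hRdeg hε (fun t ht h0 => ?_) 0
    rw [hR, eval_sub, eval_mul, h0, mul_zero, sub_zero]
    exact hval t ht h0
  have hV2 : derivative (derivative V) = R := by
    have hJ2 : derivative (derivative J) = C m * rodrigues n := derivative_two_jacobi n
    rw [hV, derivative_sub, derivative_C_mul, derivative_sub, derivative_C_mul, hJ2, ← mul_assoc,
      ← C_mul, div_mul_cancel₀ _ hconst, hR]
    rfl
  have hJ0 : J.eval (-1) = 0 := by simp [hJ]
  have hJ1 : (derivative J).eval (-1) = 0 := by
    simp [hJ, derivative_mul, derivative_pow]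
  have hJs : J.eval s = 0 := by rw [hJ, eval_mul, hroot, mul_zero]
  have hVs : V.eval s = S.eval s := by simp [hV, hJs]
  have hV0 : V.eval (-1) = S.eval (-1) := by simp [hV, hJ0]
  have hV1 : (derivative V).eval (-1) = (derivative S).eval (-1) := by
    simp [hV, hJ1]
  have hmem : (-1 : ℝ) ∈ Set.Icc (-1 : ℝ) 1 := by simp
  have hVd : ∀ t ∈ Set.Icc (-1 : ℝ) 1, |(derivative V).eval t| ≤ ε + 2 * (K * ε) := by
    intro t ht
    have h1 := abs_eval_sub_le (derivative V) (K * ε) (by rwa [hV2]) t (-1) ht hmem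
    rw [hV1] at h1
    have := abs_sub_abs_le_abs_sub ((derivative V).eval t) ((derivative S).eval (-1))
    linarith
  have h2 := abs_eval_sub_le V _ hVd s (-1) (Set.Ioo_subset_Icc_self hs) hmem
  rw [hVs, hV0] at h2
  have := abs_sub_abs_le_abs_sub (S.eval s) (S.eval (-1))
  linarith

end Reference

section Element

open Polynomial

/-- The affine map from `[-1,1]` onto `[p,q]`, as a polynomial. -/
noncomputable def affPoly (p q : ℝ) : ℝ[X] := C ((p + q) / 2) + C ((q - p) / 2) * X

theorem eval_affPoly (p q s : ℝ) : (affPoly p q).eval s = affMap p q s := by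
  simp [affPoly, affMap]
  ring

theorem iterate_derivative_comp_affPoly (p q : ℝ) (Q : ℝ[X]) (j : ℕ) :
    derivative^[j] (Q.comp (affPoly p q))
      = C (((q - p) / 2) ^ j) * (derivative^[j] Q).comp (affPoly p q) := by
  induction j with
  | zero => simp
  | succ j ih =>
    rw [Function.iterate_succ_apply', ih, derivative_C_mul, derivative_comp,
      Function.iterate_succ_apply']
    have : derivative (affPoly p q) = C ((q - p) / 2) := by simp [affPoly]
    rw [this, pow_succ, C_mul]
    ring

theorem eval_iterate_derivative_comp_affPoly (p q : ℝ) (Q : ℝ[X]) (j : ℕ) (s : ℝ) :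
    (derivative^[j] (Q.comp (affPoly p q))).eval s
      = ((q - p) / 2) ^ j * (derivative^[j] Q).eval (affMap p q s) := by
  rw [iterate_derivative_comp_affPoly, eval_mul, eval_C, eval_comp, eval_affPoly]

theorem natDegree_comp_affPoly_le (p q : ℝ) (Q : ℝ[X]) :
    (Q.comp (affPoly p q)).natDegree ≤ Q.natDegree := by
  have h1 : (affPoly p q).natDegree ≤ 1 := by
    unfold affPoly
    compute_degree
  refine natDegree_comp_le.trans ?_
  nlinarith

theorem affMap_mem_Icc {p q s : ℝ} (hpq : p ≤ q) (hs : s ∈ Set.Icc (-1 : ℝ) 1) :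
    affMap p q s ∈ Set.Icc p q := by
  unfold affMap
  constructor <;> nlinarith [hs.1, hs.2]

theorem exists_affMap_eq {p q t : ℝ} (hpq : p < q) (ht : t ∈ Set.Icc p q) :
    ∃ s ∈ Set.Icc (-1 : ℝ) 1, affMap p q s = t := by
  have h : 0 < q - p := by linarith
  refine ⟨(2 * t - p - q) / (q - p), ⟨?_, ?_⟩, ?_⟩
  · rw [le_div_iff₀ h]; linarith [ht.1]
  · rw [div_le_iff₀ h]; linarith [ht.2]
  · unfold affMap; field_simp; ring

theorem affMap_neg_one (p q : ℝ) : affMap p q (-1) = p := by unfold affMap; ring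

theorem affMap_one (p q : ℝ) : affMap p q 1 = q := by unfold affMap; ring

/-- `t` is the image in `[p,q]` of a zero of the Legendre polynomial of degree `n`. -/
def IsGaussPoint (n : ℕ) (p q t : ℝ) : Prop :=
  ∃ s ∈ Set.Ioo (-1 : ℝ) 1, legendre n s = 0 ∧ affMap p q s = t

theorem IsGaussPoint.mem_Icc {n : ℕ} {p q t : ℝ} (hpq : p ≤ q) (h : IsGaussPoint n p q t) :
    t ∈ Set.Icc p q := by
  obtain ⟨s, hs, -, rfl⟩ := h
  exact affMap_mem_Icc hpq (Set.Ioo_subset_Icc_self hs)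

theorem exists_lebesgue_constant_element (n : ℕ) : ∃ K > 0, ∀ (p q : ℝ), p < q →
    ∀ (Q : ℝ[X]) (ε : ℝ), Q.degree < n → 0 ≤ ε →
    (∀ t, IsGaussPoint n p q t → |Q.eval t| ≤ ε) →
    ∀ j, ∀ t ∈ Set.Icc p q, ((q - p) / 2) ^ j * |(derivative^[j] Q).eval t| ≤ K * ε := by
  obtain ⟨K, hK, hleb⟩ := exists_lebesgue_constant n
  refine ⟨K, hK, fun p q hpq Q ε hQ hε hval j t ht => ?_⟩
  obtain ⟨s, hs, rfl⟩ := exists_affMap_eq hpq ht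
  have hdeg : (Q.comp (affPoly p q)).degree < n := by
    by_cases h0 : Q = 0
    · simp [h0]
    · refine degree_le_natDegree.trans_lt ?_
      rw [degree_eq_natDegree h0] at hQ
      have := natDegree_comp_affPoly_le p q Q
      norm_cast at hQ ⊢
      omega
  have := hleb (Q.comp (affPoly p q)) ε hdeg hε (fun s hs h0 => by
    rw [eval_comp, eval_affPoly]
    exact hval _ ⟨s, hs, (legendre_eq_zero_iff n s).2 h0, rfl⟩) j s hs
  rw [eval_iterate_derivative_comp_affPoly, abs_mul, abs_pow, abs_of_pos (by linarith)] at this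
  exact this

theorem exists_gauss_quadrature_constant_element (n : ℕ) : ∃ K > 0, ∀ (p q : ℝ), p < q →
    ∀ (S : ℝ[X]) (ε : ℝ), S.natDegree ≤ 2 * n → 0 ≤ ε →
    (∀ t, IsGaussPoint n p q t → |(derivative S).eval t| ≤ ε) →
    |S.eval q - S.eval p| ≤ K * ((q - p) * ε) := by
  obtain ⟨K, hK, hquad⟩ := exists_gauss_quadrature_constant n
  refine ⟨K, hK, fun p q hpq S ε hS hε hval => ?_⟩
  have hH : 0 < q - p := by linarith
  have := hquad (S.comp (affPoly p q)) ((q - p) * ε) ((natDegree_comp_affPoly_le p q S).trans hS)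
    (by positivity) (fun s hs h0 => by
      have h1 := eval_iterate_derivative_comp_affPoly p q S 1 s
      simp only [Function.iterate_one, pow_one] at h1
      rw [h1, abs_mul, abs_of_pos (by linarith)]
      have h2 := hval _ ⟨s, hs, (legendre_eq_zero_iff n s).2 h0, rfl⟩
      nlinarith)
  simpa only [eval_comp, eval_affPoly, affMap_one, affMap_neg_one] using this

theorem exists_jacobi_point_constant_element (n : ℕ) (hn : 2 ≤ n) : ∃ K > 0, ∀ (p q : ℝ), p < q →
    ∀ (S : ℝ[X]) (ε : ℝ), S.natDegree ≤ n + 2 → 0 ≤ ε →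
    |S.eval p| ≤ ε → (q - p) * |(derivative S).eval p| ≤ ε →
    (∀ t, IsGaussPoint n p q t → (q - p) ^ 2 * |(derivative (derivative S)).eval t| ≤ ε) →
    ∀ s ∈ Set.Ioo (-1 : ℝ) 1, iteratedDeriv 2 (legendre n) s = 0 →
      |S.eval (affMap p q s)| ≤ K * ε := by
  obtain ⟨K, hK, hjac⟩ := exists_jacobi_point_constant n hn
  refine ⟨K, hK, fun p q hpq S ε hS hε hS0 hS1 hval s hs hroot => ?_⟩
  have hH : 0 < (q - p) / 2 := by linarith
  have := hjac (S.comp (affPoly p q)) ε ((natDegree_comp_affPoly_le p q S).trans hS) hε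
    (by rwa [eval_comp, eval_affPoly, affMap_neg_one])
    (by
      have h1 := eval_iterate_derivative_comp_affPoly p q S 1 (-1)
      simp only [Function.iterate_one, pow_one] at h1
      rw [h1, affMap_neg_one, abs_mul, abs_of_pos hH]
      nlinarith [abs_nonneg ((derivative S).eval p)])
    (fun s hs h0 => by
      rw [eval_iterate_derivative_comp_affPoly p q S 2 s, abs_mul, abs_of_pos (by positivity)]
      have h2 := hval _ ⟨s, hs, (legendre_eq_zero_iff n s).2 h0, rfl⟩
      simp only [Function.iterate_succ_apply', Function.iterate_zero, id_eq]
      nlinarith [abs_nonneg ((derivative (derivative S)).eval (affMap p q s)),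
        mul_nonneg (sq_nonneg (q - p)) (abs_nonneg ((derivative (derivative S)).eval (affMap p q s)))])
    s hs ((iteratedDeriv_two_legendre_eq_zero_iff n s).1 hroot)
  rwa [eval_comp, eval_affPoly] at this

/-- The Taylor polynomial of `f` at `p` with `n` terms. -/
noncomputable def taylorPoly (f : ℝ → ℝ) (n : ℕ) (p : ℝ) : ℝ[X] :=
  ∑ i ∈ Finset.range n, C (iteratedDeriv i f p / i.factorial) * (X - C p) ^ i

theorem degree_taylorPoly_lt (f : ℝ → ℝ) (n : ℕ) (p : ℝ) : (taylorPoly f n p).degree < n := by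
  refine (degree_sum_le _ _).trans_lt ?_
  rw [Finset.sup_lt_iff (by exact_mod_cast bot_lt_iff_ne_bot.2 (by simp))]
  intro i hi
  rw [Finset.mem_range] at hi
  refine degree_le_natDegree.trans_lt (Nat.cast_lt.2 (lt_of_le_of_lt ?_ hi))
  refine (natDegree_C_mul_le _ _).trans ?_
  rw [natDegree_pow, natDegree_X_sub_C, mul_one]

theorem eval_taylorPoly_self (f : ℝ → ℝ) (n : ℕ) (p : ℝ) :
    (taylorPoly f (n + 1) p).eval p = f p := by
  rw [taylorPoly, eval_finsetSum, Finset.sum_eq_single 0]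
  · simp
  · intro i _ hi
    simp [hi]
  · simp

theorem derivative_taylorPoly (f : ℝ → ℝ) (n : ℕ) (p : ℝ) :
    derivative (taylorPoly f (n + 1) p) = taylorPoly (deriv f) n p := by
  rw [taylorPoly, derivative_sum, Finset.sum_range_succ']
  simp only [pow_zero, mul_one, derivative_C, add_zero]
  refine Finset.sum_congr rfl fun i _ => ?_
  rw [derivative_C_mul, derivative_X_sub_C_pow, iteratedDeriv_succ', Nat.factorial_succ,
    Nat.add_sub_cancel, ← mul_assoc, ← C_mul]
  congr 2
  have := i.factorial_ne_zero
  push_cast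
  field_simp

theorem iterate_derivative_taylorPoly (f : ℝ → ℝ) (n j : ℕ) (p : ℝ) :
    derivative^[j] (taylorPoly f (n + j) p) = taylorPoly (iteratedDeriv j f) n p := by
  induction j generalizing f with
  | zero => simp
  | succ j ih =>
    rw [Function.iterate_succ_apply, ← add_assoc, derivative_taylorPoly, ih, ← iteratedDeriv_succ']

/-- Taylor's theorem with a bound on the remainder. -/
theorem abs_sub_taylorPoly_le (n : ℕ) (f : ℝ → ℝ) (p q M : ℝ) (hf : ContDiff ℝ n f)
    (hM : ∀ t ∈ Set.Icc p q, |iteratedDeriv n f t| ≤ M) :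
    ∀ t ∈ Set.Icc p q, |f t - (taylorPoly f n p).eval t| ≤ M * (q - p) ^ n := by
  induction n generalizing f with
  | zero => simpa [taylorPoly] using hM
  | succ n ih =>
    intro t ht
    have hd : ContDiff ℝ n (deriv f) := by
      have := (contDiff_succ_iff_deriv (n := n)).1 (by exact_mod_cast hf)
      exact this.2.2
    have hdiff : Differentiable ℝ f := hf.differentiable (by simp)
    have hb := ih (deriv f) hd (by simpa only [← iteratedDeriv_succ'] using hM)
    have hmv := Convex.norm_image_sub_le_of_norm_deriv_le
      (f := fun t => f t - (taylorPoly f (n + 1) p).eval t) (C := M * (q - p) ^ n)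
      (s := Set.Icc p q) (x := p) (y := t)
      (fun x _ => (hdiff x).sub (Polynomial.differentiableAt _))
      (fun x hx => by
        rw [deriv_fun_sub (hdiff x) (Polynomial.differentiableAt _), Polynomial.deriv,
          derivative_taylorPoly]
        exact hb x hx)
      (convex_Icc p q) ⟨le_rfl, ht.1.trans ht.2⟩ ht
    simp only [eval_taylorPoly_self, sub_self, sub_zero, Real.norm_eq_abs] at hmv
    rw [abs_of_nonneg (a := t - p) (by linarith [ht.1])] at hmv
    have h0 : 0 ≤ M * (q - p) ^ n := (abs_nonneg _).trans (hb t ht)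
    calc _ ≤ M * (q - p) ^ n * (t - p) := hmv
      _ ≤ M * (q - p) ^ n * (q - p) := by gcongr; exact ht.2
      _ = _ := by ring

end Element

section Duality

open scoped ContDiff

/-- The derivatives of `f` up to order `n` are bounded by `M` on `[p,q]`. -/
def DerivBounded (f : ℝ → ℝ) (n : ℕ) (p q M : ℝ) : Prop :=
  ∀ j ≤ n, ∀ t ∈ Set.Icc p q, |iteratedDeriv j f t| ≤ M

theorem DerivBounded.mul {f g : ℝ → ℝ} {n : ℕ} {p q A B : ℝ} (hf : ContDiff ℝ n f)
    (hg : ContDiff ℝ n g) (hA : 0 ≤ A) (hB : 0 ≤ B) (hfA : DerivBounded f n p q A)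
    (hgB : DerivBounded g n p q B) : DerivBounded (f * g) n p q (2 ^ n * A * B) := by
  intro j hj t ht
  have hjn : (j : WithTop ℕ∞) ≤ n := by exact_mod_cast hj
  rw [iteratedDeriv_mul (hf.of_le hjn).contDiffAt (hg.of_le hjn).contDiffAt]
  have h1 : ∀ i ∈ Finset.range (j + 1),
      |(j.choose i : ℝ) * iteratedDeriv i f t * iteratedDeriv (j - i) g t| ≤ j.choose i * (A * B) := by
    intro i hi
    rw [Finset.mem_range] at hi
    rw [abs_mul, abs_mul, Nat.abs_cast, mul_assoc]
    gcongr
    · exact hfA i (by omega) t ht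
    · exact hgB (j - i) (by omega) t ht
  refine (Finset.abs_sum_le_sum_abs _ _).trans ((Finset.sum_le_sum h1).trans ?_)
  rw [← Finset.sum_mul, mul_assoc]
  gcongr
  have h2 : ((∑ i ∈ Finset.range (j + 1), j.choose i : ℕ) : ℝ) ≤ 2 ^ n := by
    rw [Nat.sum_range_choose]
    push_cast
    exact pow_le_pow_right₀ (by norm_num) hj
  exact_mod_cast h2

/-- The two-point operator `-α e'' + β e' + γ e`. -/
noncomputable def bvpOp (α β γ : ℝ) (e : ℝ → ℝ) : ℝ → ℝ :=
  fun t => -α * iteratedDeriv 2 e t + β * deriv e t + γ * e t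

theorem contDiff_iteratedDeriv {e : ℝ → ℝ} {n m : ℕ} (he : ContDiff ℝ (n + m : ℕ) e) :
    ContDiff ℝ n (iteratedDeriv m e) := by
  rw [iteratedDeriv_eq_iterate]
  exact ContDiff.iterate_deriv' n m (by exact_mod_cast he)

theorem iteratedDeriv_iteratedDeriv (e : ℝ → ℝ) (i j : ℕ) :
    iteratedDeriv i (iteratedDeriv j e) = iteratedDeriv (i + j) e := by
  simp only [iteratedDeriv_eq_iterate, Function.iterate_add_apply]

theorem contDiff_bvpOp (α β γ : ℝ) {e : ℝ → ℝ} {n : ℕ} (he : ContDiff ℝ (n + 2 : ℕ) e) :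
    ContDiff ℝ n (bvpOp α β γ e) := by
  have h1 : ContDiff ℝ n (iteratedDeriv 1 e) :=
    contDiff_iteratedDeriv (he.of_le (by norm_cast; omega))
  rw [iteratedDeriv_one] at h1
  have h0 : ContDiff ℝ n e := he.of_le (by norm_cast; omega)
  exact ((contDiff_const.mul (contDiff_iteratedDeriv he)).add (contDiff_const.mul h1)).add
    (contDiff_const.mul h0)

theorem derivBounded_bvpOp {α β γ : ℝ} {e : ℝ → ℝ} {n : ℕ} {p q M : ℝ}
    (he : ContDiff ℝ (n + 2 : ℕ) e) (hM : DerivBounded e (n + 2) p q M) :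
    DerivBounded (bvpOp α β γ e) n p q ((|α| + |β| + |γ|) * M) := by
  intro j hj t ht
  have hjn : (j : WithTop ℕ∞) ≤ n := by exact_mod_cast hj
  have h2 : ContDiff ℝ j (iteratedDeriv 2 e) := (contDiff_iteratedDeriv he).of_le hjn
  have h1 : ContDiff ℝ j (iteratedDeriv 1 e) :=
    contDiff_iteratedDeriv (he.of_le (by norm_cast; omega))
  have h0 : ContDiff ℝ j e := he.of_le (by norm_cast; omega)
  have heq : bvpOp α β γ e
      = (fun t => -α * iteratedDeriv 2 e t) + (fun t => β * iteratedDeriv 1 e t)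
        + fun t => γ * e t := by
    ext t
    simp [bvpOp, iteratedDeriv_one]
  have c2 : ContDiff ℝ j fun t => -α * iteratedDeriv 2 e t := contDiff_const.mul h2
  have c1 : ContDiff ℝ j fun t => β * iteratedDeriv 1 e t := contDiff_const.mul h1
  have c0 : ContDiff ℝ j fun t => γ * e t := contDiff_const.mul h0
  have c21 : ContDiff ℝ j ((fun t => -α * iteratedDeriv 2 e t) + fun t => β * iteratedDeriv 1 e t) :=
    c2.add c1
  rw [heq, iteratedDeriv_add c21.contDiffAt c0.contDiffAt,
    iteratedDeriv_add c2.contDiffAt c1.contDiffAt]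
  simp only [iteratedDeriv_const_mul_field, iteratedDeriv_iteratedDeriv]
  refine (abs_add_three _ _ _).trans ?_
  simp only [abs_mul, abs_neg]
  have b2 := hM (j + 2) (by omega) t ht
  have b1 := hM (j + 1) (by omega) t ht
  have b0 := hM j (by omega) t ht
  nlinarith [mul_le_mul_of_nonneg_left b2 (abs_nonneg α),
    mul_le_mul_of_nonneg_left b1 (abs_nonneg β), mul_le_mul_of_nonneg_left b0 (abs_nonneg γ)]

/-- A solution of the homogeneous adjoint equation `-α φ'' - β φ' + γ φ = 0`. -/
def IsAdjointSol (α β γ : ℝ) (φ : ℝ → ℝ) : Prop :=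
  ContDiff ℝ ∞ φ ∧ ∀ t, -α * iteratedDeriv 2 φ t - β * deriv φ t + γ * φ t = 0

theorem IsAdjointSol.comp_sub_const {α β γ : ℝ} {φ : ℝ → ℝ} (h : IsAdjointSol α β γ φ) (t₀ : ℝ) :
    IsAdjointSol α β γ (fun s => φ (s - t₀)) := by
  refine ⟨h.1.comp (contDiff_id.sub contDiff_const), fun t => ?_⟩
  have := h.2 (t - t₀)
  rw [iteratedDeriv_comp_sub_const, deriv_comp_sub_const]
  exact this

theorem IsAdjointSol.deriv {α β γ : ℝ} {φ : ℝ → ℝ} (h : IsAdjointSol α β γ φ) :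
    IsAdjointSol α β γ (deriv φ) := by
  have hd : ∀ j, Differentiable ℝ (iteratedDeriv j φ) := fun j =>
    h.1.differentiable_iteratedDeriv j (by exact_mod_cast WithTop.coe_lt_top _)
  refine ⟨(contDiff_infty_iff_deriv.1 h.1).2, fun t => ?_⟩
  have h1 : HasDerivAt (fun t => -α * iteratedDeriv 2 φ t - β * iteratedDeriv 1 φ t
      + γ * iteratedDeriv 0 φ t) (-α * iteratedDeriv 3 φ t - β * iteratedDeriv 2 φ t
      + γ * iteratedDeriv 1 φ t) t := by
    refine ((HasDerivAt.const_mul _ ?_).sub (HasDerivAt.const_mul _ ?_)).add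
      (HasDerivAt.const_mul _ ?_)
    · rw [iteratedDeriv_succ (n := 2)]; exact (hd 2 t).hasDerivAt
    · rw [iteratedDeriv_succ (n := 1)]; exact (hd 1 t).hasDerivAt
    · rw [iteratedDeriv_succ (n := 0)]; exact (hd 0 t).hasDerivAt
  have h2 : (fun t => -α * iteratedDeriv 2 φ t - β * iteratedDeriv 1 φ t
      + γ * iteratedDeriv 0 φ t) = fun _ => 0 := by
    ext t
    simpa [iteratedDeriv_one, iteratedDeriv_zero] using h.2 t
  rw [h2] at h1
  have h3 := h1.unique (hasDerivAt_const t (0 : ℝ))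
  have e3 : iteratedDeriv 2 (_root_.deriv φ) = iteratedDeriv 3 φ := iteratedDeriv_succ'.symm
  have e2 : _root_.deriv (_root_.deriv φ) = iteratedDeriv 2 φ := by
    rw [iteratedDeriv_succ, iteratedDeriv_one]
  rw [e3, e2, ← iteratedDeriv_one]
  exact h3

/-- The fundamental solution of the adjoint equation. -/
theorem exists_adjointSol (α β γ d : ℝ) (hα : 0 < α) (hγ : 0 ≤ γ) (hd : 0 < d) :
    ∃ ψ : ℝ → ℝ, IsAdjointSol α β γ ψ ∧ ψ 0 = 0 ∧ deriv ψ 0 = 1 ∧ ψ (-d) ≠ 0 := by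
  set w := √(β ^ 2 + 4 * α * γ) with hw
  have hw2 : w ^ 2 = β ^ 2 + 4 * α * γ := Real.sq_sqrt (by positivity)
  set l := (β + w) / (2 * α) with hl
  set m := (β - w) / (2 * α) with hm
  have hsum : α * (l + m) = β := by rw [hl, hm]; field_simp; ring
  have hprod : α * (l * m) = -γ := by
    rw [hl, hm]; field_simp; linear_combination -hw2
  set E : ℝ → ℝ := fun t => ∫ s in (0 : ℝ)..t, Real.exp ((l - m) * s) with hE
  have hcont : Continuous fun s : ℝ => Real.exp ((l - m) * s) := by fun_prop
  have hEd : ∀ t, HasDerivAt E (Real.exp ((l - m) * t)) t := fun t =>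
    integral_hasDerivAt_right (hcont.intervalIntegrable _ _)
      (hcont.stronglyMeasurableAtFilter _ _) hcont.continuousAt
  have hEsm : ContDiff ℝ ∞ E := by
    rw [contDiff_infty_iff_deriv]
    refine ⟨fun t => (hEd t).differentiableAt, ?_⟩
    rw [show deriv E = fun t => Real.exp ((l - m) * t) from funext fun t => (hEd t).deriv]
    fun_prop
  have hE0 : E 0 = 0 := by simp [hE]
  have hEneg : E (-d) < 0 := by
    have hmono : StrictMono E := strictMono_of_deriv_pos fun t => by
      rw [(hEd t).deriv]; positivity
    rw [← hE0]
    exact hmono (by linarith)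
  have hexp : ∀ c t : ℝ, HasDerivAt (fun t => Real.exp (-c * t)) (-c * Real.exp (-c * t)) t := by
    intro c t
    have := ((hasDerivAt_id t).const_mul (-c)).exp
    simpa [mul_comm] using this
  set ψ : ℝ → ℝ := fun t => Real.exp (-l * t) * E t with hψ
  have hψ1 : ∀ t, HasDerivAt ψ (-l * ψ t + Real.exp (-m * t)) t := by
    intro t
    have h1 := (hexp l t).mul (hEd t)
    have h2 : Real.exp (-l * t) * Real.exp ((l - m) * t) = Real.exp (-m * t) := by
      rw [← Real.exp_add]; ring_nf
    rw [h2] at h1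
    exact h1.congr_deriv (by rw [hψ]; ring)
  have hd1 : deriv ψ = fun t => -l * ψ t + Real.exp (-m * t) := funext fun t => (hψ1 t).deriv
  have hψ2 : ∀ t, HasDerivAt (deriv ψ)
      (-l * (-l * ψ t + Real.exp (-m * t)) + -m * Real.exp (-m * t)) t := by
    intro t
    rw [hd1]
    exact ((hψ1 t).const_mul (-l)).add (hexp m t)
  refine ⟨ψ, ⟨?_, fun t => ?_⟩, by simp [hψ, hE0], by rw [hd1]; simp [hψ, hE0], ?_⟩
  · exact ContDiff.mul (by fun_prop) hEsm
  · rw [iteratedDeriv_succ, iteratedDeriv_one, (hψ2 t).deriv, hd1]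
    linear_combination (l * ψ t - Real.exp (-m * t)) * (-hsum) + ψ t * hprod
  · exact mul_ne_zero (Real.exp_ne_zero _) hEneg.ne

/-- The boundary form of Lagrange's identity. -/
noncomputable def bracket (α β : ℝ) (φ e : ℝ → ℝ) : ℝ → ℝ :=
  fun t => -α * (φ t * deriv e t - deriv φ t * e t) + β * φ t * e t

theorem hasDerivAt_bracket {α β γ : ℝ} {φ e : ℝ → ℝ} (hφ : IsAdjointSol α β γ φ)
    (he : ContDiff ℝ 2 e) (t : ℝ) :
    HasDerivAt (bracket α β φ e) ((φ * bvpOp α β γ e) t) t := by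
  have d0 : ∀ {f : ℝ → ℝ}, ContDiff ℝ 2 f → HasDerivAt f (deriv f t) t := fun hf =>
    (hf.differentiable (by norm_num) t).hasDerivAt
  have d1 : ∀ {f : ℝ → ℝ}, ContDiff ℝ 2 f → HasDerivAt (deriv f) (iteratedDeriv 2 f t) t := by
    intro f hf
    have h := hf.differentiable_iteratedDeriv 1 (by norm_num)
    rw [iteratedDeriv_succ (n := 1), iteratedDeriv_one] at *
    exact (h t).hasDerivAt
  have hφ2 : ContDiff ℝ 2 φ := contDiff_infty.1 hφ.1 2
  have h := (((d0 hφ2).mul (d1 he)).sub ((d1 hφ2).mul (d0 he))).const_mul (-α)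
  have h' := h.add (((d0 hφ2).const_mul β).mul (d0 he))
  refine h'.congr_deriv ?_
  simp only [Pi.mul_apply, bvpOp]
  linear_combination (-e t) * hφ.2 t

theorem abs_sub_le_of_telescope {N : ℕ} {x : ℕ → ℝ} {B : ℕ → ℝ → ℝ} {K t : ℝ} {i : ℕ}
    (hmatch : ∀ j ∈ Finset.Icc 1 (N - 1), B j (x j) = B (j + 1) (x j))
    (hinc : ∀ j ∈ Finset.Icc 1 N, |B j (x j) - B j (x (j - 1))| ≤ K * (x j - x (j - 1)))
    (hi : i ∈ Finset.Icc 1 N) (ht : |B i t - B i (x (i - 1))| ≤ K * (t - x (i - 1))) :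
    |B i t - B 1 (x 0)| ≤ K * (t - x 0) := by
  have key : ∀ j ∈ Finset.Icc 1 N, |B j (x (j - 1)) - B 1 (x 0)| ≤ K * (x (j - 1) - x 0) := by
    intro j hj
    rw [Finset.mem_Icc] at hj
    obtain ⟨h1, h2⟩ := hj
    induction j, h1 using Nat.le_induction with
    | base => simp
    | succ m hm ih =>
      have h3 := ih (by omega)
      have h4 := hinc m (Finset.mem_Icc.2 ⟨hm, by omega⟩)
      have h5 := hmatch m (Finset.mem_Icc.2 ⟨hm, by omega⟩)
      rw [Nat.add_sub_cancel, ← h5]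
      have := abs_sub_le (B m (x m)) (B m (x (m - 1))) (B 1 (x 0))
      linarith
  have := abs_sub_le (B i t) (B i (x (i - 1))) (B 1 (x 0))
  linarith [key i hi]

/-- Members of the family of test functions: translates of `ψ` and `ψ'`. -/
def IsTestFun (ψ : ℝ → ℝ) (a b : ℝ) (φ : ℝ → ℝ) : Prop :=
  ∃ t₀ ∈ Set.Icc a b, φ = (fun s => ψ (s - t₀)) ∨ φ = fun s => deriv ψ (s - t₀)

theorem IsMesh.le_of_le {a b : ℝ} {N : ℕ} {x : ℕ → ℝ} (h : IsMesh a b N x) {i j : ℕ}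
    (hij : i ≤ j) (hj : j ≤ N) : x i ≤ x j := by
  induction j, hij using Nat.le_induction with
  | base => exact le_rfl
  | succ m hm ih => exact (ih (by omega)).trans (h.2.2.2 m (by omega)).le

theorem IsMesh.element_subset {a b : ℝ} {N : ℕ} {x : ℕ → ℝ} (h : IsMesh a b N x) {i : ℕ}
    (hi : i ∈ Finset.Icc 1 N) : Set.Icc (x (i - 1)) (x i) ⊆ Set.Icc a b := by
  rw [Finset.mem_Icc] at hi
  rw [← h.2.1, ← h.2.2.1]
  exact Set.Icc_subset_Icc (h.le_of_le (by omega) (by omega)) (h.le_of_le hi.2 le_rfl)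

/-- Pointwise bounds for a `C¹` piecewise smooth function vanishing at both ends, from bounds on
the increments of its Lagrange brackets. -/
theorem exists_duality_constant {α β γ d : ℝ} {ψ : ℝ → ℝ} (hα : 0 < α) (hd : 0 < d)
    (hψ : IsAdjointSol α β γ ψ) (hψ0 : ψ 0 = 0) (hψ1 : deriv ψ 0 = 1) (hψd : ψ (-d) ≠ 0) :
    ∃ C > 0, ∀ (a b : ℝ), b - a = d → ∀ (N : ℕ) (x : ℕ → ℝ), IsMesh a b N x →
      ∀ e : ℕ → ℝ → ℝ,
        (∀ j ∈ Finset.Icc 1 (N - 1), e j (x j) = e (j + 1) (x j)) →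
        (∀ j ∈ Finset.Icc 1 (N - 1), deriv (e j) (x j) = deriv (e (j + 1)) (x j)) →
        e 1 a = 0 → e N b = 0 → ∀ K : ℝ, 0 ≤ K →
        (∀ φ, IsTestFun ψ a b φ → ∀ j ∈ Finset.Icc 1 N,
          |bracket α β φ (e j) (x j) - bracket α β φ (e j) (x (j - 1))| ≤ K * (x j - x (j - 1))) →
        ∀ i ∈ Finset.Icc 1 N, ∀ t ∈ Set.Icc (x (i - 1)) (x i),
        (∀ φ, IsTestFun ψ a b φ →
          |bracket α β φ (e i) t - bracket α β φ (e i) (x (i - 1))| ≤ K * (t - x (i - 1))) →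
        |e i t| ≤ C * K ∧ |deriv (e i) t| ≤ C * K := by
  have hcont0 : Continuous ψ := hψ.1.continuous
  have hcont1 : Continuous (deriv ψ) := hψ.deriv.1.continuous
  obtain ⟨B0, hB0⟩ := isCompact_Icc.exists_bound_of_continuousOn (s := Set.Icc (-d) 0)
    hcont0.continuousOn
  obtain ⟨B1, hB1⟩ := isCompact_Icc.exists_bound_of_continuousOn (s := Set.Icc (-d) 0)
    hcont1.continuousOn
  have hB0' : 0 ≤ B0 := (norm_nonneg _).trans (hB0 0 ⟨by linarith, le_rfl⟩)
  have hB1' : 0 ≤ B1 := (norm_nonneg _).trans (hB1 0 ⟨by linarith, le_rfl⟩)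
  have hpd : 0 < |ψ (-d)| := abs_pos.2 hψd
  set c₁ := d / (α * |ψ (-d)|) with hc₁
  have hc₁pos : 0 < c₁ := by positivity
  refine ⟨(d + α * (B0 + B1) * c₁) / α, by positivity, ?_⟩
  intro a b hab N x hmesh e hm0 hm1 hea heb K hK hinc i hi t ht hit
  have hx0 : x 0 = a := hmesh.2.1
  have hxN : x N = b := hmesh.2.2.1
  have hN : N ∈ Finset.Icc 1 N := Finset.mem_Icc.2 ⟨hmesh.1, le_rfl⟩
  have htab := hmesh.element_subset hi ht
  have hmatch : ∀ φ, ∀ j ∈ Finset.Icc 1 (N - 1),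
      bracket α β φ (e j) (x j) = bracket α β φ (e (j + 1)) (x j) := by
    intro φ j hj
    simp only [bracket, hm0 j hj, hm1 j hj]
  have hψ2 : deriv (deriv ψ) 0 = -β / α := by
    have := hψ.2 0
    rw [hψ0, hψ1, iteratedDeriv_succ, iteratedDeriv_one] at this
    field_simp
    linarith
  have hda : |deriv (e 1) a| ≤ c₁ * K := by
    have hφ : IsTestFun ψ a b (fun s => ψ (s - b)) := ⟨b, ⟨by linarith, le_rfl⟩, Or.inl rfl⟩
    have h := abs_sub_le_of_telescope (hmatch _) (hinc _ hφ) hN (hinc _ hφ N hN)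
    rw [hx0, hxN, hab] at h
    have e1 : bracket α β (fun s => ψ (s - b)) (e N) b = 0 := by simp [bracket, heb, hψ0]
    have e2 : bracket α β (fun s => ψ (s - b)) (e 1) a = -(α * ψ (-d) * deriv (e 1) a) := by
      simp only [bracket, hea, show a - b = -d by linarith]; ring
    rw [e1, e2, zero_sub, neg_neg, abs_mul, abs_mul, abs_of_pos hα] at h
    rw [hc₁, div_mul_eq_mul_div, le_div_iff₀ (by positivity)]
    linarith
  have hat : a - t ∈ Set.Icc (-d) 0 := ⟨by linarith [htab.2], by linarith [htab.1]⟩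
  have hKt : K * (t - a) ≤ K * d := mul_le_mul_of_nonneg_left (by linarith [htab.2]) hK
  have fin : ∀ z y : ℝ, |α * z| ≤ K * d + α * (|y| * |deriv (e 1) a|) → |y| ≤ B0 + B1 →
      |z| ≤ (d + α * (B0 + B1) * c₁) / α * K := by
    intro z y hz hy
    rw [div_mul_eq_mul_div, le_div_iff₀ hα]
    rw [abs_mul, abs_of_pos hα] at hz
    have : |y| * |deriv (e 1) a| ≤ (B0 + B1) * (c₁ * K) :=
      mul_le_mul hy hda (abs_nonneg _) (by positivity)
    nlinarith
  constructor
  · have hφ : IsTestFun ψ a b (fun s => ψ (s - t)) := ⟨t, htab, Or.inl rfl⟩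
    have h := abs_sub_le_of_telescope (hmatch _) (hinc _ hφ) hi (hit _ hφ)
    rw [hx0] at h
    have e1 : bracket α β (fun s => ψ (s - t)) (e i) t = α * e i t := by
      simp [bracket, hψ0, deriv_comp_sub_const, hψ1]
    have e2 : bracket α β (fun s => ψ (s - t)) (e 1) a = -α * (ψ (a - t) * deriv (e 1) a) := by
      simp [bracket, hea]
    rw [e1, e2] at h
    refine fin _ (ψ (a - t)) ?_ ((hB0 _ hat).trans (by linarith))
    have h2 := abs_sub_abs_le_abs_sub (α * e i t) (-α * (ψ (a - t) * deriv (e 1) a))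
    rw [abs_mul (-α), abs_neg, abs_of_pos hα, abs_mul (ψ _)] at h2
    linarith
  · have hφ : IsTestFun ψ a b (fun s => deriv ψ (s - t)) := ⟨t, htab, Or.inr rfl⟩
    have h := abs_sub_le_of_telescope (hmatch _) (hinc _ hφ) hi (hit _ hφ)
    rw [hx0] at h
    have e1 : bracket α β (fun s => deriv ψ (s - t)) (e i) t = -(α * deriv (e i) t) := by
      simp only [bracket, deriv_comp_sub_const (f := deriv ψ), sub_self, hψ1, hψ2]
      field_simp
      ring
    have e2 : bracket α β (fun s => deriv ψ (s - t)) (e 1) a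
        = -α * (deriv ψ (a - t) * deriv (e 1) a) := by
      simp [bracket, hea]
    rw [e1, e2] at h
    refine fin _ (deriv ψ (a - t)) ?_ ((hB1 _ hat).trans (by linarith))
    have h2 := abs_sub_abs_le_abs_sub (-(α * deriv (e i) t)) (-α * (deriv ψ (a - t) * deriv (e 1) a))
    rw [abs_neg, abs_mul (-α), abs_neg, abs_of_pos hα, abs_mul (deriv ψ _)] at h2
    linarith

end Duality

section Local

open Polynomial
open scoped ContDiff

/-- The error `u - P` on an element. -/
noncomputable def errFun (u : ℝ → ℝ) (P : ℝ[X]) : ℝ → ℝ := fun t => u t - P.eval t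

theorem contDiff_polynomial_eval (P : ℝ[X]) {n : ℕ∞ω} : ContDiff ℝ n fun t => P.eval t := by
  simpa [aeval_def] using P.contDiff_aeval (𝕜 := ℝ) n

theorem contDiff_errFun {u : ℝ → ℝ} {n : ℕ∞ω} (hu : ContDiff ℝ n u) (P : ℝ[X]) :
    ContDiff ℝ n (errFun u P) :=
  hu.sub (contDiff_polynomial_eval P)

theorem iteratedDeriv_errFun {u : ℝ → ℝ} {j : ℕ} (hu : ContDiff ℝ j u) (P : ℝ[X]) (t : ℝ) :
    iteratedDeriv j (errFun u P) t = iteratedDeriv j u t - (derivative^[j] P).eval t := by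
  have h : errFun u P = u - fun t => P.eval t := rfl
  rw [h, iteratedDeriv_sub hu.contDiffAt (contDiff_polynomial_eval P).contDiffAt, iteratedDeriv_polynomial_eval]

theorem abs_sub_le_of_deriv_bound {f : ℝ → ℝ} {p q E : ℝ} (hf : Differentiable ℝ f)
    (hE : ∀ t ∈ Set.Icc p q, |deriv f t| ≤ E) {t : ℝ} (ht : t ∈ Set.Icc p q) :
    |f t - f p| ≤ (q - p) * E := by
  have h := Convex.norm_image_sub_le_of_norm_deriv_le (f := f) (C := E) (s := Set.Icc p q)
    (x := p) (y := t) (fun x _ => hf x) hE (convex_Icc p q) ⟨le_rfl, ht.1.trans ht.2⟩ ht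
  rw [Real.norm_eq_abs, Real.norm_eq_abs, abs_of_nonneg (a := t - p) (by linarith [ht.1])] at h
  have : 0 ≤ E := (abs_nonneg _).trans (hE t ht)
  nlinarith [ht.2]

/-- Perturbation estimate for the defect and the derivatives of the collocation error on one
element, in terms of a bound `E` on the error in `C²`. -/
theorem exists_element_error_constant (n : ℕ) (hn : 1 ≤ n) (α β γ : ℝ) (hα : 0 < α) :
    ∃ K > 0, ∀ (p q : ℝ), p < q → q - p ≤ 1 → ∀ (u : ℝ → ℝ) (m : ℕ), n ≤ m →
      ContDiff ℝ (m + 2 : ℕ) u → ∀ M, 0 ≤ M → DerivBounded u (m + 2) p q M →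
      ∀ P : ℝ[X], P.natDegree ≤ n + 1 → ∀ E, 0 ≤ E → DerivBounded (errFun u P) 2 p q E →
      (∀ t, IsGaussPoint n p q t → bvpOp α β γ (errFun u P) t = 0) →
      (∀ t ∈ Set.Icc p q, |bvpOp α β γ (errFun u P) t| ≤ K * ((q - p) * E + (q - p) ^ n * M)) ∧
      ∀ j ≤ m, ∀ t ∈ Set.Icc p q, (q - p) ^ (n - 1) * |iteratedDeriv (j + 2) (errFun u P) t|
        ≤ K * ((q - p) ^ (n - 1) * (M + E) + ((q - p) * E + (q - p) ^ n * M)) := by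
  obtain ⟨K₀, hK₀, hleb⟩ := exists_lebesgue_constant_element n
  set c₁ := (|β| + |γ|) / α with hc₁
  have hc₁0 : 0 ≤ c₁ := by positivity
  have hαc : α * c₁ = |β| + |γ| := by rw [hc₁]; field_simp
  refine ⟨α + α * (K₀ * (1 + c₁)) + (|β| + |γ|) + (1 + c₁) + 2 ^ n * (K₀ * (1 + c₁)),
    by positivity, ?_⟩
  intro p q hpq hH1 u m hnm hu M hM huM P hP E hE heE hres
  set e := errFun u P with he
  have hH : 0 < q - p := by linarith
  set H := q - p with hHdef
  set δ := H * E + H ^ n * M with hδ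
  have hδ0 : 0 ≤ δ := by positivity
  have hHE : H * E ≤ δ := by rw [hδ]; linarith [show 0 ≤ H ^ n * M by positivity]
  have hHM : H ^ n * M ≤ δ := by rw [hδ]; linarith [show 0 ≤ H * E by positivity]
  have hesm : ContDiff ℝ (m + 2 : ℕ) e := contDiff_errFun hu P
  have hediff : Differentiable ℝ e := hesm.differentiable (by norm_cast)
  have hed' : Differentiable ℝ (deriv e) := by
    have := hesm.differentiable_iteratedDeriv 1 (by norm_cast; omega)
    rwa [iteratedDeriv_one] at this
  have hp : p ∈ Set.Icc p q := ⟨le_rfl, hpq.le⟩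
  have he0 : ∀ t ∈ Set.Icc p q, |e t| ≤ E := fun t ht => by
    simpa using heE 0 (by norm_num) t ht
  have he1 : ∀ t ∈ Set.Icc p q, |deriv e t| ≤ E := fun t ht => by
    simpa [iteratedDeriv_one] using heE 1 (by norm_num) t ht
  have he2 : ∀ t ∈ Set.Icc p q, |deriv (deriv e) t| ≤ E := fun t ht => by
    have := heE 2 (by norm_num) t ht
    rwa [iteratedDeriv_succ, iteratedDeriv_one] at this
  have hosc : ∀ t ∈ Set.Icc p q,
      |(β * deriv e t + γ * e t) - (β * deriv e p + γ * e p)| ≤ (|β| + |γ|) * (H * E) := by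
    intro t ht
    have a1 := abs_sub_le_of_deriv_bound hed' he2 ht
    have a0 := abs_sub_le_of_deriv_bound hediff he1 ht
    have : (β * deriv e t + γ * e t) - (β * deriv e p + γ * e p)
        = β * (deriv e t - deriv e p) + γ * (e t - e p) := by ring
    rw [this]
    refine (abs_add_le _ _).trans ?_
    rw [abs_mul, abs_mul, add_mul]
    gcongr
  set κ := (β * deriv e p + γ * e p) / α with hκ
  have hακ : α * κ = β * deriv e p + γ * e p := by rw [hκ]; field_simp
  have hκE : |κ| ≤ c₁ * E := by
    rw [hκ, abs_div, abs_of_pos hα, hc₁, div_mul_eq_mul_div]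
    gcongr
    refine (abs_add_le _ _).trans ?_
    rw [abs_mul, abs_mul, add_mul]
    gcongr
    · exact he1 p hp
    · exact he0 p hp
  set T := taylorPoly (iteratedDeriv 2 u) n p with hT
  set R : ℝ[X] := T - derivative^[2] P - C κ with hR
  have hu2 : ContDiff ℝ 2 u := hu.of_le (by norm_cast; omega)
  have hrep : ∀ t, iteratedDeriv 2 e t = (iteratedDeriv 2 u t - T.eval t) + R.eval t + κ := by
    intro t
    rw [he, iteratedDeriv_errFun hu2, hR]
    simp only [eval_sub, eval_C]
    ring
  have hTu : ∀ t ∈ Set.Icc p q, |iteratedDeriv 2 u t - T.eval t| ≤ M * H ^ n := by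
    refine abs_sub_taylorPoly_le n (iteratedDeriv 2 u) p q M
      (contDiff_iteratedDeriv (hu.of_le (by norm_cast; omega))) fun t ht => ?_
    rw [iteratedDeriv_iteratedDeriv]
    exact huM _ (by omega) t ht
  have hRdeg : R.degree < n := by
    have h1 : (derivative^[2] P).degree < n := by
      refine degree_le_natDegree.trans_lt ?_
      have := natDegree_iterate_derivative P 2
      norm_cast
      omega
    have h2 : (C κ : ℝ[X]).degree < n := degree_C_le.trans_lt (by exact_mod_cast hn)
    refine (degree_sub_le _ _).trans_lt (max_lt ((degree_sub_le _ _).trans_lt (max_lt ?_ h1)) h2)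
    exact degree_taylorPoly_lt _ _ _
  have hRg : ∀ t, IsGaussPoint n p q t → |R.eval t| ≤ (1 + c₁) * δ := by
    intro t ht
    have htI := ht.mem_Icc hpq.le
    have h0 := hres t ht
    simp only [bvpOp] at h0
    have h1 : α * R.eval t = -(α * (iteratedDeriv 2 u t - T.eval t))
        + ((β * deriv e t + γ * e t) - (β * deriv e p + γ * e p)) := by
      rw [hrep] at h0
      linear_combination -hακ - h0
    have h2 : α * |R.eval t| ≤ α * (M * H ^ n) + (|β| + |γ|) * (H * E) := by
      rw [← abs_of_pos hα, ← abs_mul, abs_of_pos hα, h1]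
      refine (abs_add_le _ _).trans (add_le_add ?_ (hosc t htI))
      rw [abs_neg, abs_mul, abs_of_pos hα]
      exact mul_le_mul_of_nonneg_left (hTu t htI) hα.le
    rw [← hαc] at h2
    have h3 : α * |R.eval t| ≤ α * ((1 + c₁) * δ) := by
      refine h2.trans ?_
      have : M * H ^ n + c₁ * (H * E) ≤ (1 + c₁) * δ := by
        nlinarith [mul_le_mul_of_nonneg_left hHE hc₁0]
      nlinarith
    exact le_of_mul_le_mul_left h3 hα
  have hRb := hleb p q hpq R ((1 + c₁) * δ) hRdeg (by positivity) hRg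
  constructor
  · intro t ht
    have h1 : bvpOp α β γ e t = -(α * (iteratedDeriv 2 u t - T.eval t)) + -(α * R.eval t)
        + ((β * deriv e t + γ * e t) - (β * deriv e p + γ * e p)) := by
      simp only [bvpOp]
      rw [hrep]
      linear_combination -hακ
    rw [h1]
    have hR0 : |R.eval t| ≤ K₀ * ((1 + c₁) * δ) := by simpa using hRb 0 t ht
    refine (abs_add_three _ _ _).trans ?_
    rw [abs_neg, abs_neg, abs_mul, abs_mul, abs_of_pos hα]
    have b1 : α * |iteratedDeriv 2 u t - T.eval t| ≤ α * δ :=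
      mul_le_mul_of_nonneg_left ((hTu t ht).trans (by linarith)) hα.le
    have b2 := mul_le_mul_of_nonneg_left hR0 hα.le
    have b3 : (|β| + |γ|) * (H * E) ≤ (|β| + |γ|) * δ := by gcongr
    have b4 : 0 ≤ ((1 + c₁) + 2 ^ n * (K₀ * (1 + c₁))) * δ := by positivity
    linarith [hosc t ht]
  · intro j hj t ht
    have hj2 : ContDiff ℝ (j + 2 : ℕ) u := hu.of_le (by norm_cast; omega)
    have hPrep : derivative^[j + 2] P = derivative^[j] T - derivative^[j] R - derivative^[j] (C κ) := by
      rw [Function.iterate_add_apply, ← iterate_derivative_sub, ← iterate_derivative_sub, hR]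
      congr 1
      ring
    have hTj : |iteratedDeriv (j + 2) u t - (derivative^[j] T).eval t| ≤ M := by
      rcases le_total j n with hjn | hjn
      · obtain ⟨i, rfl⟩ := Nat.exists_eq_add_of_le' hjn
        rw [hT, iterate_derivative_taylorPoly, iteratedDeriv_iteratedDeriv]
        have := abs_sub_taylorPoly_le i (iteratedDeriv (j + 2) u) p q M
          (contDiff_iteratedDeriv (hu.of_le (by norm_cast; omega))) (fun t ht => by
            rw [iteratedDeriv_iteratedDeriv]
            exact huM _ (by omega) t ht) t ht
        exact this.trans (mul_le_of_le_one_right hM (pow_le_one₀ hH.le hH1))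
      · rw [iterate_derivative_eq_zero_of_degree_lt
          ((degree_taylorPoly_lt _ _ _).trans_le (by exact_mod_cast hjn))]
        simpa using huM (j + 2) (by omega) t ht
    have hκj : |(derivative^[j] (C κ)).eval t| ≤ c₁ * E := by
      rcases j with _ | j
      · simpa using hκE
      · rw [iterate_derivative_C (by omega)]
        simp only [eval_zero, abs_zero]
        positivity
    have hRj : H ^ (n - 1) * |(derivative^[j] R).eval t| ≤ 2 ^ n * (K₀ * ((1 + c₁) * δ)) := by
      rcases lt_or_ge j n with hjn | hjn
      · have h1 : H ^ (n - 1) ≤ 2 ^ n * (H / 2) ^ j := by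
          have : (2 : ℝ) ^ n * (H / 2) ^ j = 2 ^ (n - j) * H ^ j := by
            rw [div_pow, ← Nat.sub_add_cancel hjn.le, pow_add, Nat.add_sub_cancel]
            field_simp
          rw [this]
          calc H ^ (n - 1) ≤ H ^ j := pow_le_pow_of_le_one hH.le hH1 (by omega)
            _ ≤ 2 ^ (n - j) * H ^ j :=
              le_mul_of_one_le_left (by positivity) (one_le_pow₀ (by norm_num))
        calc _ ≤ 2 ^ n * (H / 2) ^ j * |(derivative^[j] R).eval t| := by gcongr
          _ = 2 ^ n * ((H / 2) ^ j * |(derivative^[j] R).eval t|) := by ring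
          _ ≤ _ := mul_le_mul_of_nonneg_left (hRb j t ht) (by positivity)
      · rw [iterate_derivative_eq_zero_of_degree_lt (hRdeg.trans_le (by exact_mod_cast hjn))]
        simp only [eval_zero, abs_zero, mul_zero]
        positivity
    have hej : iteratedDeriv (j + 2) e t = (iteratedDeriv (j + 2) u t - (derivative^[j] T).eval t)
        + (derivative^[j] R).eval t + (derivative^[j] (C κ)).eval t := by
      rw [he, iteratedDeriv_errFun hj2, hPrep]
      simp only [eval_sub]
      ring
    have hHn : 0 ≤ H ^ (n - 1) := by positivity
    rw [hej]
    have b1 := mul_le_mul_of_nonneg_left (abs_add_three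
      (iteratedDeriv (j + 2) u t - (derivative^[j] T).eval t) ((derivative^[j] R).eval t)
      ((derivative^[j] (C κ)).eval t)) hHn
    have b2 := mul_le_mul_of_nonneg_left hTj hHn
    have b3 := mul_le_mul_of_nonneg_left hκj hHn
    have b4 : H ^ (n - 1) * M + H ^ (n - 1) * (c₁ * E) ≤ (1 + c₁) * (H ^ (n - 1) * (M + E)) := by
      have : 0 ≤ H ^ (n - 1) * E + c₁ * (H ^ (n - 1) * M) := by positivity
      linarith
    set A := H ^ (n - 1) * (M + E) with hA
    have hA0 : 0 ≤ A := by positivity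
    have b5 : 0 ≤ (α + α * (K₀ * (1 + c₁)) + (|β| + |γ|) + 2 ^ n * (K₀ * (1 + c₁))) * A := by
      positivity
    have b6 : 0 ≤ (α + α * (K₀ * (1 + c₁)) + (|β| + |γ|) + (1 + c₁)) * δ := by positivity
    linarith

/-- The increment over one element of an antiderivative of a smooth function that vanishes at the
Gauss points. -/
theorem exists_gauss_increment_constant (n m : ℕ) (hm : m ≤ 2 * n) :
    ∃ K > 0, ∀ (p q : ℝ), p < q → ∀ G F : ℝ → ℝ, (∀ t, HasDerivAt G (F t) t) → ContDiff ℝ m F →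
      ∀ M, 0 ≤ M → DerivBounded F m p q M → (∀ t, IsGaussPoint n p q t → F t = 0) →
      |G q - G p| ≤ K * ((q - p) ^ m * M) * (q - p) := by
  obtain ⟨K, hK, hquad⟩ := exists_gauss_quadrature_constant_element n
  refine ⟨1 + K, by positivity, fun p q hpq G F hG hF M hM hFM hzero => ?_⟩
  have hdG : deriv G = F := funext fun t => (hG t).deriv
  have hGsm : ContDiff ℝ (m + 1 : ℕ) G := by
    have := (contDiff_succ_iff_deriv (n := m) (f := G)).2
      ⟨fun t => (hG t).differentiableAt, by simp, by rwa [hdG]⟩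
    exact_mod_cast this
  set S := taylorPoly G (m + 1) p with hS
  have hS' : derivative S = taylorPoly F m p := by rw [hS, derivative_taylorPoly, hdG]
  have hq : q ∈ Set.Icc p q := ⟨hpq.le, le_rfl⟩
  have h1 := abs_sub_taylorPoly_le m F p q M hF (hFM m le_rfl)
  have h2 := abs_sub_taylorPoly_le (m + 1) G p q M hGsm (by
    rw [iteratedDeriv_succ', hdG]
    exact hFM m le_rfl) q hq
  have hdeg : S.natDegree ≤ 2 * n := by
    refine natDegree_le_of_degree_le ?_
    have h := degree_taylorPoly_lt G (m + 1) p
    refine (Order.le_of_lt_succ ?_ : S.degree ≤ m).trans (by exact_mod_cast hm)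
    exact_mod_cast h
  have hH : 0 < q - p := by linarith
  have h3 := hquad p q hpq S (M * (q - p) ^ m) hdeg (by positivity) fun t ht => by
    have := h1 t (ht.mem_Icc hpq.le)
    rwa [hzero t ht, zero_sub, abs_neg, ← hS'] at this
  have h4 : S.eval p = G p := eval_taylorPoly_self G m p
  rw [h4] at h3
  rw [pow_succ] at h2
  have := abs_sub_le (G q) (S.eval q) (G p)
  linarith

/-- Superconvergence at the Jacobi points of one element, given good Cauchy data at its left end. -/
theorem exists_jacobi_error_constant (n : ℕ) (hn : 2 ≤ n) (α β γ : ℝ) (hα : 0 < α) :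
    ∃ K > 0, ∀ (p q : ℝ), p < q → q - p ≤ 1 → ∀ e : ℝ → ℝ, ContDiff ℝ (n + 3 : ℕ) e →
      ∀ M, 0 ≤ M → DerivBounded e (n + 3) p q M → ∀ E δ, 0 ≤ E → 0 ≤ δ →
      (∀ t ∈ Set.Icc p q, |iteratedDeriv 2 e t| ≤ E) → |e p| ≤ δ → |deriv e p| ≤ δ →
      (∀ t, IsGaussPoint n p q t → bvpOp α β γ e t = 0) →
      ∀ s ∈ Set.Ioo (-1 : ℝ) 1, iteratedDeriv 2 (legendre n) s = 0 →
      |e (affMap p q s)| ≤ K * (δ + (q - p) ^ 3 * E + (q - p) ^ (n + 3) * M) := by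
  obtain ⟨K, hK, hjac⟩ := exists_jacobi_point_constant_element n hn
  set c₁ := (|β| + |γ|) / α with hc₁
  have hc₁0 : 0 ≤ c₁ := by positivity
  have hαc : α * c₁ = |β| + |γ| := by rw [hc₁]; field_simp
  refine ⟨1 + K * (1 + 2 * c₁), by positivity, ?_⟩
  intro p q hpq hH1 e he M hM heM E δ hE hδ heE he0 he1 hres s hs hroot
  have hH : 0 < q - p := by linarith
  set H := q - p with hHdef
  set ε := δ + H ^ 3 * E + H ^ (n + 3) * M with hε
  have hε0 : 0 ≤ ε := by positivity
  have hδε : δ ≤ ε := by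
    rw [hε]; linarith [show 0 ≤ H ^ 3 * E by positivity, show 0 ≤ H ^ (n + 3) * M by positivity]
  have hediff : Differentiable ℝ e := he.differentiable (by norm_cast)
  have hed' : Differentiable ℝ (deriv e) := by
    have := he.differentiable_iteratedDeriv 1 (by norm_cast; omega)
    rwa [iteratedDeriv_one] at this
  have hd1 : ∀ t ∈ Set.Icc p q, |deriv e t| ≤ δ + H * E := by
    intro t ht
    have h := abs_sub_le_of_deriv_bound hed' (fun t ht => by
      have := heE t ht
      rwa [iteratedDeriv_succ, iteratedDeriv_one] at this) ht
    have := abs_sub_abs_le_abs_sub (deriv e t) (deriv e p)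
    linarith
  have hd0 : ∀ t ∈ Set.Icc p q, |e t| ≤ 2 * δ + H * E := by
    intro t ht
    have h := abs_sub_le_of_deriv_bound hediff hd1 ht
    have := abs_sub_abs_le_abs_sub (e t) (e p)
    have : H * (δ + H * E) ≤ 1 * (δ + H * E) :=
      mul_le_mul_of_nonneg_right hH1 (by positivity)
    linarith
  set S := taylorPoly e (n + 3) p with hS
  have hS1 : derivative S = taylorPoly (deriv e) (n + 2) p := derivative_taylorPoly e (n + 2) p
  have hS2 : derivative (derivative S) = taylorPoly (iteratedDeriv 2 e) (n + 1) p := by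
    rw [hS1, derivative_taylorPoly, iteratedDeriv_succ, iteratedDeriv_one]
  have hT := abs_sub_taylorPoly_le (n + 3) e p q M he (heM _ le_rfl)
  have hT2 := abs_sub_taylorPoly_le (n + 1) (iteratedDeriv 2 e) p q M
    (contDiff_iteratedDeriv he) (fun t ht => by
      rw [iteratedDeriv_iteratedDeriv]
      exact heM _ (by omega) t ht)
  have hdeg : S.natDegree ≤ n + 2 := by
    refine natDegree_le_of_degree_le ?_
    have h := degree_taylorPoly_lt e (n + 3) p
    refine (Order.le_of_lt_succ ?_ : S.degree ≤ (n + 2 : ℕ))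
    exact_mod_cast h
  have hSg : ∀ t, IsGaussPoint n p q t → H ^ 2 * |(derivative (derivative S)).eval t|
      ≤ (1 + 2 * c₁) * ε := by
    intro t ht
    have htI := ht.mem_Icc hpq.le
    have h0 := hres t ht
    simp only [bvpOp] at h0
    have h1 : α * |iteratedDeriv 2 e t| ≤ α * (c₁ * (2 * δ + H * E)) := by
      rw [← abs_of_pos hα, ← abs_mul, abs_of_pos hα,
        show α * iteratedDeriv 2 e t = β * deriv e t + γ * e t by linarith, ← mul_assoc, hαc]
      refine (abs_add_le _ _).trans ?_
      rw [abs_mul, abs_mul, add_mul]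
      gcongr
      · exact (hd1 t htI).trans (by linarith)
      · exact hd0 t htI
    have h2 := le_of_mul_le_mul_left h1 hα
    have h3 := hT2 t htI
    rw [← hS2] at h3
    have h4 := abs_sub_abs_le_abs_sub ((derivative (derivative S)).eval t) (iteratedDeriv 2 e t)
    rw [abs_sub_comm] at h4
    have h5 : |(derivative (derivative S)).eval t| ≤ c₁ * (2 * δ + H * E) + M * H ^ (n + 1) := by
      linarith
    have h6 := mul_le_mul_of_nonneg_left h5 (sq_nonneg H)
    refine h6.trans ?_
    have e1 : H ^ 2 * (c₁ * (2 * δ + H * E) + M * H ^ (n + 1))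
        = 2 * c₁ * (H ^ 2 * δ) + c₁ * (H ^ 3 * E) + H ^ (n + 3) * M := by ring
    rw [e1]
    have e2 : H ^ 2 * δ ≤ δ := mul_le_of_le_one_left hδ (pow_le_one₀ hH.le hH1)
    have e3 := mul_le_mul_of_nonneg_left e2 hc₁0
    have e4 : 0 ≤ c₁ * (H ^ 3 * E) + 2 * c₁ * (H ^ (n + 3) * M) + H ^ 3 * E + δ := by positivity
    rw [hε]
    linarith
  have hε1 : ε ≤ (1 + 2 * c₁) * ε := by nlinarith
  have hSp : S.eval p = e p := eval_taylorPoly_self e (n + 2) p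
  have hSp1 : (derivative S).eval p = deriv e p := by
    rw [hS1]; exact eval_taylorPoly_self (deriv e) (n + 1) p
  have h := hjac p q hpq S ((1 + 2 * c₁) * ε) hdeg (by positivity) (by rw [hSp]; linarith)
    (by
      rw [hSp1]
      have : H * |deriv e p| ≤ 1 * |deriv e p| := mul_le_mul_of_nonneg_right hH1 (abs_nonneg _)
      linarith) hSg s hs hroot
  have h2 := hT _ (affMap_mem_Icc hpq.le (Set.Ioo_subset_Icc_self hs))
  have h3 := abs_sub_abs_le_abs_sub (e (affMap p q s)) (S.eval (affMap p q s))
  have h4 : M * H ^ (n + 3) ≤ ε := by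
    rw [hε]; linarith [show 0 ≤ H ^ 3 * E by positivity]
  linarith

end Local

section Global

open Polynomial
open scoped ContDiff

theorem exists_testFun_constant {α β γ : ℝ} {ψ : ℝ → ℝ} (hψ : IsAdjointSol α β γ ψ) (d : ℝ)
    (m : ℕ) : ∃ B > 0, ∀ (a b : ℝ), b - a = d → ∀ φ, IsTestFun ψ a b φ →
      IsAdjointSol α β γ φ ∧ DerivBounded φ m a b B := by
  have hbd : ∀ j, ∃ B, ∀ t ∈ Set.Icc (-d) d, |iteratedDeriv j ψ t| ≤ B := fun j =>
    isCompact_Icc.exists_bound_of_continuousOn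
      (hψ.1.continuous_iteratedDeriv j (by exact_mod_cast le_top)).continuousOn
  choose B hB using hbd
  have hle : ∀ j ≤ m + 1, B j ≤ 1 + ∑ i ∈ Finset.range (m + 2), |B i| := fun j hj => by
    have := Finset.single_le_sum (f := fun i => |B i|) (fun i _ => abs_nonneg _)
      (Finset.mem_range.2 (by omega : j < m + 2))
    linarith [le_abs_self (B j)]
  refine ⟨1 + ∑ i ∈ Finset.range (m + 2), |B i|, by positivity, ?_⟩
  rintro a b hab φ ⟨t₀, ht₀, rfl | rfl⟩
  · refine ⟨hψ.comp_sub_const t₀, fun j hj t ht => ?_⟩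
    rw [iteratedDeriv_comp_sub_const]
    exact (hB j _ ⟨by linarith [ht.1, ht₀.2], by linarith [ht.2, ht₀.1]⟩).trans (hle j (by omega))
  · refine ⟨hψ.deriv.comp_sub_const t₀, fun j hj t ht => ?_⟩
    rw [iteratedDeriv_comp_sub_const, ← iteratedDeriv_succ']
    exact (hB (j + 1) _ ⟨by linarith [ht.1, ht₀.2], by linarith [ht.2, ht₀.1]⟩).trans
      (hle (j + 1) (by omega))

/-- The functions `e i` on the elements form a `C¹` function vanishing at both ends. -/
def IsC1Matching (a b : ℝ) (N : ℕ) (x : ℕ → ℝ) (e : ℕ → ℝ → ℝ) : Prop :=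
  (∀ j ∈ Finset.Icc 1 (N - 1), e j (x j) = e (j + 1) (x j)) ∧
  (∀ j ∈ Finset.Icc 1 (N - 1), deriv (e j) (x j) = deriv (e (j + 1)) (x j)) ∧
  e 1 a = 0 ∧ e N b = 0

theorem IsMesh.lt {a b : ℝ} {N : ℕ} {x : ℕ → ℝ} (h : IsMesh a b N x) {i : ℕ}
    (hi : i ∈ Finset.Icc 1 N) : x (i - 1) < x i := by
  rw [Finset.mem_Icc] at hi
  have := h.2.2.2 (i - 1) (by omega)
  rwa [Nat.sub_add_cancel hi.1] at this

/-- Stability of the two-point boundary value problem in `C²`. -/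
theorem exists_stability_constant {α β γ d : ℝ} (hα : 0 < α) (hγ : 0 ≤ γ) (hd : 0 < d) :
    ∃ C > 0, ∀ (a b : ℝ), b - a = d → ∀ (N : ℕ) (x : ℕ → ℝ), IsMesh a b N x →
      ∀ e : ℕ → ℝ → ℝ, (∀ i, ContDiff ℝ 2 (e i)) → IsC1Matching a b N x e → ∀ ρ, 0 ≤ ρ →
      (∀ i ∈ Finset.Icc 1 N, ∀ t ∈ Set.Icc (x (i - 1)) (x i), |bvpOp α β γ (e i) t| ≤ ρ) →
      ∀ i ∈ Finset.Icc 1 N, DerivBounded (e i) 2 (x (i - 1)) (x i) (C * ρ) := by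
  obtain ⟨ψ, hψ, hψ0, hψ1, hψd⟩ := exists_adjointSol α β γ d hα hγ hd
  obtain ⟨C, hC, hdual⟩ := exists_duality_constant hα hd hψ hψ0 hψ1 hψd
  obtain ⟨B, hB, htest⟩ := exists_testFun_constant hψ d 0
  refine ⟨C * B + (1 + (|β| + |γ|) * (C * B)) / α, by positivity, ?_⟩
  intro a b hab N x hmesh e he hmatch ρ hρ hres i hi
  have hinc : ∀ φ, IsTestFun ψ a b φ → ∀ j ∈ Finset.Icc 1 N, ∀ t ∈ Set.Icc (x (j - 1)) (x j),
      |bracket α β φ (e j) t - bracket α β φ (e j) (x (j - 1))| ≤ B * ρ * (t - x (j - 1)) := by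
    intro φ hφ j hj t ht
    obtain ⟨hadj, hbd⟩ := htest a b hab φ hφ
    have h := Convex.norm_image_sub_le_of_norm_deriv_le (f := bracket α β φ (e j)) (C := B * ρ)
      (s := Set.Icc (x (j - 1)) (x j)) (x := x (j - 1)) (y := t)
      (fun y _ => (hasDerivAt_bracket hadj (he j) y).differentiableAt) (fun y hy => by
        rw [(hasDerivAt_bracket hadj (he j) y).deriv, Pi.mul_apply, norm_mul]
        have h0 := hbd 0 le_rfl y (hmesh.element_subset hj hy)
        rw [iteratedDeriv_zero] at h0
        exact mul_le_mul h0 (hres j hj y hy) (norm_nonneg _) hB.le)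
      (convex_Icc _ _) ⟨le_rfl, ht.1.trans ht.2⟩ ht
    rwa [Real.norm_eq_abs, Real.norm_eq_abs, abs_of_nonneg (a := t - _) (by linarith [ht.1])] at h
  have hmain := hdual a b hab N x hmesh e hmatch.1 hmatch.2.1 hmatch.2.2.1 hmatch.2.2.2 (B * ρ)
    (by positivity) (fun φ hφ j hj => hinc φ hφ j hj _ ⟨(hmesh.lt hj).le, le_rfl⟩) i hi
  intro j hj t ht
  obtain ⟨h0, h1⟩ := hmain t ht fun φ hφ => hinc φ hφ i hi t ht
  have hpos : 0 ≤ (1 + (|β| + |γ|) * (C * B)) / α * ρ := by positivity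
  have hpos' : 0 ≤ C * B * ρ := by positivity
  rw [add_mul]
  interval_cases j
  · rw [iteratedDeriv_zero]; linarith
  · rw [iteratedDeriv_one]; linarith
  · suffices |iteratedDeriv 2 (e i) t| ≤ (1 + (|β| + |γ|) * (C * B)) / α * ρ by linarith
    rw [div_mul_eq_mul_div, le_div_iff₀ hα, mul_comm, ← abs_of_pos hα, ← abs_mul,
      show α * iteratedDeriv 2 (e i) t = -bvpOp α β γ (e i) t + β * deriv (e i) t + γ * e i t by
        simp only [bvpOp]; ring]
    refine (abs_add_three _ _ _).trans ?_
    rw [abs_neg, abs_mul, abs_mul]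
    have b0 := mul_le_mul_of_nonneg_left h0 (abs_nonneg γ)
    have b1 := mul_le_mul_of_nonneg_left h1 (abs_nonneg β)
    linarith [hres i hi t ht]

theorem exists_max_on_elements {a b : ℝ} {N : ℕ} {x : ℕ → ℝ} (hmesh : IsMesh a b N x)
    {g : ℕ → ℝ → ℝ} (hg : ∀ i, Continuous (g i)) :
    ∃ i ∈ Finset.Icc 1 N, ∃ t ∈ Set.Icc (x (i - 1)) (x i),
      ∀ j ∈ Finset.Icc 1 N, ∀ s ∈ Set.Icc (x (j - 1)) (x j), |g j s| ≤ |g i t| := by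
  have hmax : ∀ i, ∃ t, i ∈ Finset.Icc 1 N → t ∈ Set.Icc (x (i - 1)) (x i) ∧
      ∀ s ∈ Set.Icc (x (i - 1)) (x i), |g i s| ≤ |g i t| := fun i => by
    by_cases hi : i ∈ Finset.Icc 1 N
    · obtain ⟨t, ht, hts⟩ := isCompact_Icc.exists_isMaxOn
        (Set.nonempty_Icc.2 (hmesh.lt hi).le) (hg i).abs.continuousOn
      exact ⟨t, fun _ => ⟨ht, fun s hs => hts hs⟩⟩
    · exact ⟨0, fun h => absurd h hi⟩
  choose T hT using hmax
  obtain ⟨i, hi, himax⟩ := Finset.exists_max_image (Finset.Icc 1 N) (fun i => |g i (T i)|)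
    ⟨1, Finset.mem_Icc.2 ⟨le_rfl, hmesh.1⟩⟩
  exact ⟨i, hi, T i, (hT i hi).1, fun j hj s hs => ((hT j hj).2 s hs).trans (himax j hj)⟩

/-- Global error bounds for the collocation method: order `n` in `C²`, and boundedness of the
higher derivatives. -/
theorem exists_global_error_constant (n : ℕ) (hn : 1 ≤ n) {α β γ c d : ℝ} (hα : 0 < α)
    (hγ : 0 ≤ γ) (hc : 1 ≤ c) (hd : 0 < d) :
    ∃ K > 0, ∃ h₀ > 0, h₀ ≤ 1 ∧ ∀ (a b : ℝ), b - a = d → ∀ (N : ℕ) (x : ℕ → ℝ) (h : ℝ),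
      IsMesh a b N x → IsMeshSize N x h → IsQuasiUniform N x h c → h ≤ h₀ →
      ∀ (u : ℝ → ℝ) (m : ℕ), n ≤ m → ContDiff ℝ (m + 2 : ℕ) u → ∀ M, 0 ≤ M →
      DerivBounded u (m + 2) a b M → ∀ P : ℕ → ℝ[X],
      (∀ i ∈ Finset.Icc 1 N, (P i).natDegree ≤ n + 1) →
      IsC1Matching a b N x (fun i => errFun u (P i)) →
      (∀ i ∈ Finset.Icc 1 N, ∀ t, IsGaussPoint n (x (i - 1)) (x i) t →
        bvpOp α β γ (errFun u (P i)) t = 0) →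
      ∀ i ∈ Finset.Icc 1 N, DerivBounded (errFun u (P i)) 2 (x (i - 1)) (x i) (K * (h ^ n * M)) ∧
        DerivBounded (errFun u (P i)) (m + 2) (x (i - 1)) (x i) (K * M) := by
  obtain ⟨C, hC, hstab⟩ := exists_stability_constant (β := β) hα hγ hd
  obtain ⟨K₁, hK₁, helem⟩ := exists_element_error_constant n hn α β γ hα
  set C₂ := C * (2 * K₁) with hC₂
  have hC₂0 : 0 < C₂ := by positivity
  refine ⟨C₂ + K₁ * (2 + 2 * (C₂ * c ^ n)), by positivity, min 1 (1 / (2 * K₁ * C)),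
    by positivity, min_le_left _ _, ?_⟩
  intro a b hab N x h hmesh hsize hqu hh u m hnm hu M hM huM P hP hmatch hres
  have hh1 : h ≤ 1 := hh.trans (min_le_left _ _)
  have hh2 : 2 * K₁ * C * h ≤ 1 := by
    have := hh.trans (min_le_right _ _)
    rw [le_div_iff₀ (by positivity)] at this
    linarith
  have hlen : ∀ i ∈ Finset.Icc 1 N, 0 < x i - x (i - 1) := fun i hi => sub_pos.2 (hmesh.lt hi)
  have hh0 : 0 < h := by
    obtain ⟨i, hi, rfl⟩ := hsize.2
    exact hlen i hi
  have hesm : ∀ i, ContDiff ℝ (m + 2 : ℕ) (errFun u (P i)) := fun i => contDiff_errFun hu _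
  have he2 : ∀ i, ContDiff ℝ 2 (errFun u (P i)) := fun i =>
    (hesm i).of_le (by norm_cast; omega)
  obtain ⟨i₀, hi₀, t₀, ht₀, hmax⟩ := exists_max_on_elements hmesh
    (g := fun i => bvpOp α β γ (errFun u (P i)))
    fun i => (contDiff_bvpOp α β γ (n := 0) (by exact_mod_cast he2 i)).continuous
  set ρ := |bvpOp α β γ (errFun u (P i₀)) t₀| with hρdef
  have hρ : 0 ≤ ρ := abs_nonneg _
  have hE := hstab a b hab N x hmesh _ he2 hmatch ρ hρ hmax
  have huMi : ∀ i ∈ Finset.Icc 1 N, DerivBounded u (m + 2) (x (i - 1)) (x i) M :=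
    fun i hi j hj t ht => huM j hj t (hmesh.element_subset hi ht)
  have hloc := fun i hi => helem _ _ (hmesh.lt hi) ((hsize.1 i hi).trans hh1) u m hnm hu M hM
    (huMi i hi) (P i) (hP i hi) (C * ρ) (by positivity) (hE i hi) (hres i hi)
  have hρle : ρ ≤ 2 * K₁ * (h ^ n * M) := by
    have h1 := (hloc i₀ hi₀).1 t₀ ht₀
    have hl := hlen i₀ hi₀
    have h2 : K₁ * ((x i₀ - x (i₀ - 1)) * (C * ρ) + (x i₀ - x (i₀ - 1)) ^ n * M)
        ≤ K₁ * (h * (C * ρ) + h ^ n * M) := by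
      gcongr <;> exact hsize.1 i₀ hi₀
    have h3 := mul_le_mul_of_nonneg_right hh2 hρ
    linarith
  have hEle : C * ρ ≤ C₂ * (h ^ n * M) := by
    rw [hC₂, mul_assoc]
    exact mul_le_mul_of_nonneg_left hρle hC.le
  intro i hi
  have hcpos : 0 < c := by linarith
  have hx1 : 0 ≤ K₁ * (2 + 2 * (C₂ * c ^ n)) * (h ^ n * M) := by positivity
  have hx2 : 0 ≤ K₁ * (2 + 2 * (C₂ * c ^ n)) * M := by positivity
  have hx3 : 0 ≤ C₂ * M := by positivity
  constructor
  · intro j hj t ht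
    rw [add_mul]
    linarith [hE i hi j hj t ht]
  · intro j hj t ht
    rw [add_mul]
    rcases lt_or_ge j 2 with hj2 | hj2
    · have h1 := hE i hi j hj2.le t ht
      have h2 : h ^ n * M ≤ 1 * M :=
        mul_le_mul_of_nonneg_right (pow_le_one₀ hh0.le hh1) hM
      have h3 := mul_le_mul_of_nonneg_left h2 hC₂0.le
      linarith
    · obtain ⟨j, rfl⟩ := Nat.exists_eq_add_of_le' hj2
      suffices |iteratedDeriv (j + 2) (errFun u (P i)) t| ≤ K₁ * (2 + 2 * (C₂ * c ^ n)) * M by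
        linarith
      have h1 := (hloc i hi).2 j (by omega) t ht
      have hl := hlen i hi
      have hl1 := (hsize.1 i hi).trans hh1
      have hq := hqu i hi
      set H := x i - x (i - 1) with hH
      have h2 : h ^ n * M ≤ c ^ n * (H ^ n * M) := by
        rw [← mul_assoc, ← mul_pow]
        gcongr
      have hHn : H ^ n = H ^ (n - 1) * H := by rw [← pow_succ, Nat.sub_add_cancel hn]
      have h3 : H ^ n * M ≤ H ^ (n - 1) * M := by
        rw [hHn]
        have : H ^ (n - 1) * H ≤ H ^ (n - 1) := mul_le_of_le_one_right (by positivity) hl1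
        gcongr
      have h4 : H ^ (n - 1) * M ≤ M := mul_le_of_le_one_left hM (pow_le_one₀ hl.le hl1)
      have h5 : C * ρ ≤ C₂ * c ^ n * (H ^ n * M) := by
        have := mul_le_mul_of_nonneg_left h2 hC₂0.le
        linarith
      have h6 : C * ρ ≤ C₂ * c ^ n * (H ^ (n - 1) * M) :=
        h5.trans (mul_le_mul_of_nonneg_left h3 (by positivity))
      have h7 : C * ρ ≤ C₂ * c ^ n * M :=
        h6.trans (mul_le_mul_of_nonneg_left h4 (by positivity))
      have h8 : H * (C * ρ) ≤ C * ρ := mul_le_of_le_one_left (by positivity) hl1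
      have h9 : H ^ (n - 1) * (C * ρ) ≤ H ^ (n - 1) * (C₂ * c ^ n * M) := by gcongr
      have h10 : K₁ * (H ^ (n - 1) * (M + C * ρ) + (H * (C * ρ) + H ^ n * M))
          ≤ K₁ * (H ^ (n - 1) * ((2 + 2 * (C₂ * c ^ n)) * M)) := by
        refine mul_le_mul_of_nonneg_left ?_ hK₁.le
        linarith
      refine le_of_mul_le_mul_left (h1.trans (h10.trans_eq ?_)) (pow_pos hl (n - 1))
      ring

/-- Superconvergence of value and derivative at the nodes, for an error family with bounded
higher derivatives. -/
theorem exists_nodal_error_constant (n m : ℕ) (hm : m ≤ 2 * n) {α β γ d : ℝ} (hα : 0 < α)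
    (hγ : 0 ≤ γ) (hd : 0 < d) :
    ∃ K > 0, ∀ (a b : ℝ), b - a = d → ∀ (N : ℕ) (x : ℕ → ℝ) (h : ℝ),
      IsMesh a b N x → (∀ i ∈ Finset.Icc 1 N, x i - x (i - 1) ≤ h) →
      ∀ e : ℕ → ℝ → ℝ, (∀ i, ContDiff ℝ (m + 2 : ℕ) (e i)) → IsC1Matching a b N x e →
      ∀ M, 0 ≤ M → (∀ i ∈ Finset.Icc 1 N, DerivBounded (e i) (m + 2) (x (i - 1)) (x i) M) →
      (∀ i ∈ Finset.Icc 1 N, ∀ t, IsGaussPoint n (x (i - 1)) (x i) t → bvpOp α β γ (e i) t = 0) →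
      ∀ i ∈ Finset.Icc 1 N, |e i (x (i - 1))| ≤ K * (h ^ m * M) ∧
        |deriv (e i) (x (i - 1))| ≤ K * (h ^ m * M) := by
  obtain ⟨ψ, hψ, hψ0, hψ1, hψd⟩ := exists_adjointSol α β γ d hα hγ hd
  obtain ⟨C, hC, hdual⟩ := exists_duality_constant hα hd hψ hψ0 hψ1 hψd
  obtain ⟨B, hB, htest⟩ := exists_testFun_constant hψ d m
  obtain ⟨K, hK, hgauss⟩ := exists_gauss_increment_constant n m hm
  set L := 2 ^ m * B * (|α| + |β| + |γ|) with hL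
  have hL0 : 0 < L := by
    have : 0 < |α| := abs_pos.2 hα.ne'
    positivity
  refine ⟨C * (K * L), by positivity, ?_⟩
  intro a b hab N x h hmesh hsize e he hmatch M hM heM hres i hi
  have hlt := fun j (hj : j ∈ Finset.Icc 1 N) => hmesh.lt hj
  have hh : 0 ≤ h := by linarith [hsize i hi, hlt i hi]
  have hinc : ∀ φ, IsTestFun ψ a b φ → ∀ j ∈ Finset.Icc 1 N,
      |bracket α β φ (e j) (x j) - bracket α β φ (e j) (x (j - 1))|
        ≤ K * (h ^ m * (L * M)) * (x j - x (j - 1)) := by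
    intro φ hφ j hj
    obtain ⟨hadj, hbd⟩ := htest a b hab φ hφ
    have hφm : ContDiff ℝ m φ := hadj.1.of_le (by exact_mod_cast le_top)
    have hop := contDiff_bvpOp α β γ (he j)
    have hbd' := (DerivBounded.mul hφm hop hB.le (by positivity)
      (fun l hl t ht => hbd l hl t (hmesh.element_subset hj ht))
      (derivBounded_bvpOp (he j) (heM j hj)))
    have h1 := hgauss _ _ (hlt j hj) (bracket α β φ (e j)) (φ * bvpOp α β γ (e j))
      (hasDerivAt_bracket hadj ((he j).of_le (by norm_cast; omega))) (hφm.mul hop) (L * M)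
      (by positivity) (by rw [hL, mul_assoc]; exact hbd')
      (fun t ht => by rw [Pi.mul_apply, hres j hj t ht, mul_zero])
    have hl := sub_pos.2 (hlt j hj)
    have hs := hsize j hj
    refine h1.trans ?_
    gcongr
  have hfin := hdual a b hab N x hmesh e hmatch.1 hmatch.2.1 hmatch.2.2.1 hmatch.2.2.2
    (K * (h ^ m * (L * M))) (by positivity) hinc i hi (x (i - 1)) ⟨le_rfl, (hlt i hi).le⟩
    (fun φ _ => by simp)
  have heq : C * (K * (h ^ m * (L * M))) = C * (K * L) * (h ^ m * M) := by ring
  rwa [heq] at hfin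

theorem derivBounded_Icc_of_Ioo {u : ℝ → ℝ} {m : ℕ} {a b M : ℝ} (hab : a < b)
    (hu : ContDiff ℝ m u) (h : ∀ j ≤ m, ∀ y ∈ Set.Ioo a b, |iteratedDeriv j u y| ≤ M) :
    DerivBounded u m a b M := by
  intro j hj t ht
  rw [← closure_Ioo hab.ne] at ht
  refine le_on_closure (f := fun t => |iteratedDeriv j u t|) (g := fun _ => M) (h j hj) ?_ ?_ ht
  · exact (hu.continuous_iteratedDeriv j (by exact_mod_cast hj)).abs.continuousOn
  · exact continuousOn_const

theorem isC1Matching_errFun {k N : ℕ} {x : ℕ → ℝ} {P : ℕ → ℝ[X]} {u : ℝ → ℝ} {a b : ℝ}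
    (hmesh : IsMesh a b N x) (hP : IsVh0 k N x P) (hu : Differentiable ℝ u) (hua : u a = 0)
    (hub : u b = 0) : IsC1Matching a b N x (fun i => errFun u (P i)) := by
  obtain ⟨-, h0, h1, ha, hb⟩ := hP
  have hderiv : ∀ Q t, deriv (errFun u Q) t = deriv u t - (derivative Q).eval t := fun Q t =>
    ((hu t).hasDerivAt.sub (Q.hasDerivAt t)).deriv
  refine ⟨fun j hj => ?_, fun j hj => ?_, ?_, ?_⟩
  · simp only [errFun, h0 j hj]
  · rw [hderiv, hderiv, h1 j hj]
  · rw [hmesh.2.1] at ha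
    simp only [errFun, hua, ha, sub_zero]
  · rw [hmesh.2.2.1] at hb
    simp only [errFun, hub, hb, sub_zero]

theorem bvpOp_errFun_eq_zero {k N : ℕ} {x : ℕ → ℝ} {α β γ : ℝ} {P : ℕ → ℝ[X]} {u : ℝ → ℝ}
    (hu : ContDiff ℝ 2 u) (hP : IsGaussSol k N x α β γ
      (fun t => -α * iteratedDeriv 2 u t + β * deriv u t + γ * u t) P) {i : ℕ}
    (hi : i ∈ Finset.Icc 1 N) {t : ℝ} (ht : IsGaussPoint (k - 1) (x (i - 1)) (x i) t) :
    bvpOp α β γ (errFun u (P i)) t = 0 := by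
  obtain ⟨s, hs, hs0, rfl⟩ := ht
  have h := hP.2 i hi s hs hs0
  simp only [bvpOp]
  rw [iteratedDeriv_errFun hu, ← iteratedDeriv_one,
    iteratedDeriv_errFun (hu.of_le (by norm_num)), iteratedDeriv_one]
  simp only [errFun, Function.iterate_succ, Function.iterate_zero, Function.comp_apply, id]
  linarith

end Global

/-- Superconvergence of the Gauss collocation solution at the interior Jacobi points
(images of the roots of `L_{k-1}''`), for `k ≥ 4`:
`|(u - ū_h)(l_{im})| ≤ C h^{k+2} ‖u‖_{2k,∞}`. -/
theorem gauss_collocation_superconvergence_jacobi_points (k : ℕ) (hk : 4 ≤ k)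
    (α β γ c d : ℝ) (hα : 0 < α) (hγ : 0 ≤ γ) (hc : 1 ≤ c) (hd : 0 < d) :
    ∃ C > 0, ∃ h₀ > 0, ∀ (a b : ℝ), b - a = d →
      ∀ (N : ℕ) (x : ℕ → ℝ) (h : ℝ),
        IsMesh a b N x → IsMeshSize N x h → IsQuasiUniform N x h c → h ≤ h₀ →
      ∀ u : ℝ → ℝ, ContDiff ℝ (2 * k) u → u a = 0 → u b = 0 →
      ∀ Pb : ℕ → Polynomial ℝ,
        IsGaussSol k N x α β γ (fun t => -α * iteratedDeriv 2 u t + β * deriv u t + γ * u t) Pb →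
      ∀ M : ℝ, (∀ j ≤ 2 * k, ∀ y ∈ Set.Ioo a b, |iteratedDeriv j u y| ≤ M) →
        ∀ i ∈ Finset.Icc 1 N, ∀ s ∈ Set.Ioo (-1 : ℝ) 1, iteratedDeriv 2 (legendre (k - 1)) s = 0 →
          |u (affMap (x (i - 1)) (x i) s) - (Pb i).eval (affMap (x (i - 1)) (x i) s)|
            ≤ C * h ^ (k + 2) * M := by
  obtain ⟨n, rfl⟩ : ∃ n, k = n + 1 := ⟨k - 1, by omega⟩
  obtain ⟨K₁, hK₁, h₀, hh₀, hh₀1, hglob⟩ :=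
    exists_global_error_constant n (by omega) (β := β) hα hγ hc hd
  obtain ⟨K₂, hK₂, hnode⟩ :=
    exists_nodal_error_constant n (n + 3) (by omega) (β := β) hα hγ hd
  obtain ⟨K₃, hK₃, hjac⟩ := exists_jacobi_error_constant n (by omega) α β γ hα
  refine ⟨K₃ * (K₂ * K₁ + K₁ + K₁), by positivity, h₀, hh₀, ?_⟩
  intro a b hab N x h hmesh hsize hqu hh u hu hua hub P hP M hM i hi s hs hroot
  have hu' : ContDiff ℝ (2 * n + 2 : ℕ) u := by
    convert hu using 1
    push_cast
    ring
  have hu2 : ContDiff ℝ 2 u := hu'.of_le (by norm_cast; omega)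
  have hlt : a < b := by linarith
  have hM0 : 0 ≤ M :=
    (abs_nonneg _).trans (hM 0 (by omega) ((a + b) / 2) ⟨by linarith, by linarith⟩)
  have huM : DerivBounded u (2 * n + 2) a b M := derivBounded_Icc_of_Ioo hlt hu' hM
  have hmatch := isC1Matching_errFun hmesh hP.1 (hu2.differentiable (by norm_num)) hua hub
  have hres : ∀ i ∈ Finset.Icc 1 N, ∀ t, IsGaussPoint n (x (i - 1)) (x i) t →
      bvpOp α β γ (errFun u (P i)) t = 0 := fun i hi t ht => bvpOp_errFun_eq_zero hu2 hP hi ht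
  have hbd := hglob a b hab N x h hmesh hsize hqu hh u (2 * n) (by omega) hu' M hM0 huM P hP.1.1
    hmatch hres
  have hnd := hnode a b hab N x h hmesh hsize.1 (fun i => errFun u (P i))
    (fun i => contDiff_errFun (hu'.of_le (by norm_cast; omega)) _) hmatch (K₁ * M) (by positivity)
    (fun i hi j hj => (hbd i hi).2 j (by omega)) hres i hi
  have hl := sub_pos.2 (hmesh.lt hi)
  have hlh := hsize.1 i hi
  have hh0 : 0 < h := hl.trans_le hlh
  refine (hjac _ _ (hmesh.lt hi) (hlh.trans (hh.trans hh₀1)) (errFun u (P i))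
    (contDiff_errFun (hu'.of_le (by norm_cast; omega)) _) (K₁ * M) (by positivity)
    (fun j hj => (hbd i hi).2 j (by omega)) (K₁ * (h ^ n * M)) (K₂ * (h ^ (n + 3) * (K₁ * M)))
    (by positivity) (by positivity) ((hbd i hi).1 2 le_rfl) hnd.1 hnd.2 (hres i hi) s hs hroot).trans
    ?_
  calc _ ≤ K₃ * (K₂ * (h ^ (n + 3) * (K₁ * M)) + h ^ 3 * (K₁ * (h ^ n * M))
        + h ^ (n + 3) * (K₁ * M)) := by gcongr
    _ = _ := by ring
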